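/- arXiv:1606.04294 — 4 statements merged into one kernel-verified Lean document; each statement's English description precedes it below -/
import Mathlib

section
/- Let 0 < α < n and let I_α be the Riesz potential I_α f(x) = ∫_{ℝⁿ} |x−y|^{α−n} f(y) dy. Suppose p : ℝⁿ → (0,∞) satisfies the local log-Hölder condition and the log-Hölder condition at infinity, and 0 < p₋ ≤ p₊ < n/α. Define q by 1/q(x) = 1/p(x) − α/n. Then I_α extends to a bounded operator from H^{p(·)}(ℝⁿ) to H^{q(·)}(ℝⁿ): there is a constant C such that ‖I_α f‖_{H^{q(·)}} ≤ C ‖f‖_{H^{p(·)}} for all f ∈ H^{p(·)}(ℝⁿ). -/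
open MeasureTheory ENNReal

noncomputable section

abbrev Rn (n : ℕ) := EuclideanSpace ℝ (Fin n)

/-- The variable exponent Lebesgue quasinorm of an `ℝ≥0∞`-valued function. -/
def varLpNormE {n : ℕ} (p : Rn n → ℝ) (g : Rn n → ℝ≥0∞) : ℝ≥0∞ :=
  sInf {l : ℝ≥0∞ | ∃ lam : ℝ, 0 < lam ∧ l = ENNReal.ofReal lam ∧
    (∫⁻ x, (g x / ENNReal.ofReal lam) ^ (p x)) ≤ 1}

/-- The variable exponent Lebesgue quasinorm `‖f‖_{p(·)}`. -/
def varLpNorm {n : ℕ} (p : Rn n → ℝ) (f : Rn n → ℝ) : ℝ≥0∞ :=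
  varLpNormE p (fun x => ENNReal.ofReal |f x|)

/-- The local log-Hölder continuity condition. -/
def LogHolderLocal {n : ℕ} (p : Rn n → ℝ) : Prop :=
  ∃ c > 0, ∀ x y : Rn n, ‖x - y‖ < 1/2 → |p x - p y| ≤ c / (-Real.log ‖x - y‖)

/-- The log-Hölder condition at infinity. -/
def LogHolderInfty {n : ℕ} (p : Rn n → ℝ) : Prop :=
  ∃ C > 0, ∃ pinf : ℝ, ∀ x : Rn n, |p x - pinf| ≤ C / Real.log (Real.exp 1 + ‖x‖)

/-- The (closed) cube centered at `z` with side length `r`. -/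
def cube {n : ℕ} (z : Rn n) (r : ℝ) : Set (Rn n) := {x | ∀ i, |x i - z i| ≤ r / 2}

/-- The characteristic function of the cube `Q(z,r)`. -/
def cubeInd {n : ℕ} (z : Rn n) (r : ℝ) : Rn n → ℝ := Set.indicator (cube z r) 1

/-- The fractional maximal operator `M_β`. -/
def fracMax {n : ℕ} (β : ℝ) (f : Rn n → ℝ) (x : Rn n) : ℝ :=
  ⨆ (z : Rn n) (r : ℝ) (_ : 0 < r) (_ : x ∈ cube z r),
    (volume (cube z r)).toReal ^ (β / (n : ℝ) - 1) * ∫ y in cube z r, |f y|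

/-- `p̲ = min (p₋, 1)`. -/
def pUnder {n : ℕ} (p : Rn n → ℝ) : ℝ := min (⨅ x, p x) 1

/-- The quantity `𝒜({λ_j},{Q_j},p(·))`. -/
def AFun {n : ℕ} (p : Rn n → ℝ) (lam : ℕ → ℝ) (z : ℕ → Rn n) (r : ℕ → ℝ) : ℝ≥0∞ :=
  varLpNorm p (fun x =>
    (∑' j, (lam j * cubeInd (z j) (r j) x /
        (varLpNorm p (cubeInd (z j) (r j))).toReal) ^ pUnder p) ^ (1 / pUnder p))

/-- `d_{p(·)} = min {ℓ ∈ ℕ : p₋ (n + ℓ + 1) > n}` where `t` plays the role of `p₋`. -/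
def dIndex (n : ℕ) (t : ℝ) : ℕ := sInf {l : ℕ | t * (n + l + 1) > n}

/-- `p₋`, the essential lower bound of the exponent. -/
def pLow {n : ℕ} (p : Rn n → ℝ) : ℝ := ⨅ x, p x

/-- A `(p(·), p₀, d)`-atom supported in the cube `Q(z,r)`. -/
structure IsPAtom {n : ℕ} (p : Rn n → ℝ) (p₀ : ℝ) (d : ℕ) (a : Rn n → ℝ)
    (z : Rn n) (r : ℝ) : Prop where
  measurable : Measurable a
  support : ∀ x, x ∉ cube z r → a x = 0
  size : eLpNorm a (ENNReal.ofReal p₀) volume ≤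
    ENNReal.ofReal ((volume (cube z r)).toReal ^ (1 / p₀)) / varLpNorm p (cubeInd z r)
  moments : ∀ γ : Fin n → ℕ, (∑ i, γ i) ≤ d → ∫ x, a x * ∏ i, x i ^ γ i = 0

/-- Action of an `n × n` matrix on `ℝⁿ`. -/
def mApp {n : ℕ} (A : Matrix (Fin n) (Fin n) ℝ) (x : Rn n) : Rn n :=
  Matrix.toEuclideanLin A x

/-- The operator norm of a matrix acting on Euclidean space. -/
def opNorm {n : ℕ} (A : Matrix (Fin n) (Fin n) ℝ) : ℝ :=
  ‖Matrix.toEuclideanCLM (𝕜 := ℝ) A‖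

/-- The kernel `k(x,y) = |x - A₁ y|^{-α₁} ⋯ |x - A_m y|^{-α_m}`. -/
def kern {n m : ℕ} (A : Fin m → Matrix (Fin n) (Fin n) ℝ) (αe : Fin m → ℝ)
    (x y : Rn n) : ℝ :=
  ∏ i, ‖x - mApp (A i) y‖ ^ (-(αe i))

/-- The fractional type integral operator `T_α`. -/
def Tα {n m : ℕ} (A : Fin m → Matrix (Fin n) (Fin n) ℝ) (αe : Fin m → ℝ)
    (f : Rn n → ℝ) (x : Rn n) : ℝ :=
  ∫ y, kern A αe x y * f y

/-- The Riesz potential `I_α`. -/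
def riesz {n : ℕ} (α : ℝ) (f : Rn n → ℝ) (x : Rn n) : ℝ :=
  ∫ y, ‖x - y‖ ^ (α - (n : ℝ)) * f y

/-- Partial derivative in the `i`-th coordinate direction. -/
def pderiv1 {n : ℕ} (i : Fin n) (g : Rn n → ℝ) : Rn n → ℝ :=
  fun x => fderiv ℝ g x (EuclideanSpace.single i 1)

/-- The multiindex partial derivative `∂^γ`. -/
def mderiv {n : ℕ} (γ : Fin n → ℕ) (g : Rn n → ℝ) : Rn n → ℝ :=
  (List.finRange n).foldr (fun i h => (pderiv1 i)^[γ i] h) g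

/-- The finite set of multiindices `γ` with `|γ| ≤ N`. -/
def multiIndices (n N : ℕ) : Finset (Fin n → ℕ) :=
  (Fintype.piFinset fun _ => Finset.range (N+1)).filter (fun γ => (∑ i, γ i) ≤ N)

/-- The family `F_N` of normalized Schwartz test functions. -/
def FN (n N : ℕ) : Set (SchwartzMap (Rn n) ℝ) :=
  {φ | (∑ γ ∈ multiIndices n N, ⨆ x : Rn n, (1 + ‖x‖) ^ N * |mderiv γ (⇑φ) x|) ≤ 1}

/-- The grand maximal function `𝓜 f`. -/
def grandMax (n N : ℕ) (f : Rn n → ℝ) (x : Rn n) : ℝ≥0∞ :=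
  ⨆ (t : ℝ) (_ : 0 < t) (φ : FN n N),
    ENNReal.ofReal |∫ y, t ^ (-(n : ℝ)) * (φ : SchwartzMap (Rn n) ℝ) (t⁻¹ • (x - y)) * f y|

/-- The variable Hardy space quasinorm `‖f‖_{H^{p(·)}}` (with parameter `N`). -/
def hardyNorm {n : ℕ} (p : Rn n → ℝ) (N : ℕ) (f : Rn n → ℝ) : ℝ≥0∞ :=
  varLpNormE p (grandMax n N f)

/-- `γ! = γ₁! ⋯ γ_n!`. -/
def mfact {n : ℕ} (γ : Fin n → ℕ) : ℕ := ∏ i, (γ i).factorial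

/-- The degree-`d` Taylor polynomial of `g` at `z`, evaluated at `y`. -/
def taylorPoly {n : ℕ} (d : ℕ) (g : Rn n → ℝ) (z y : Rn n) : ℝ :=
  ∑ γ ∈ multiIndices n d, (mderiv γ g z / (mfact γ : ℝ)) * ∏ i, (y i - z i) ^ γ i

end


/-- Partial derivative on Schwartz space. -/
noncomputable def pdS {n : ℕ} (i : Fin n) : SchwartzMap (Rn n) ℝ →L[ℝ] SchwartzMap (Rn n) ℝ :=
  SchwartzMap.evalCLM ℝ (Rn n) ℝ (EuclideanSpace.single i (1:ℝ) : Rn n) ∘L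
    SchwartzMap.fderivCLM ℝ (Rn n) ℝ

lemma pderiv1_schwartz {n : ℕ} (i : Fin n) (φ : SchwartzMap (Rn n) ℝ) :
    pderiv1 i (⇑φ) = ⇑(pdS i φ) := rfl

lemma mderiv_rel {n : ℕ} (R : (Rn n → ℝ) → (Rn n → ℝ) → Prop)
    (hR : ∀ i g h, R g h → R (pderiv1 i g) (pderiv1 i h)) (γ : Fin n → ℕ)
    {g h : Rn n → ℝ} (H : R g h) : R (mderiv γ g) (mderiv γ h) := by
  unfold mderiv
  induction (List.finRange n) with
  | nil => simpa using H
  | cons i l ih =>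
    simp only [List.foldr_cons]
    generalize γ i = k
    induction k with
    | zero => simpa using ih
    | succ k ihk =>
      rw [Function.iterate_succ_apply', Function.iterate_succ_apply']
      exact hR _ _ _ ihk

lemma mderiv_schwartz {n : ℕ} (γ : Fin n → ℕ) (φ : SchwartzMap (Rn n) ℝ) :
    ∃ η : SchwartzMap (Rn n) ℝ, mderiv γ (⇑φ) = ⇑η := by
  have := mderiv_rel (fun g _ => ∃ η : SchwartzMap (Rn n) ℝ, g = ⇑η)
    (by rintro i g h ⟨η, rfl⟩; exact ⟨_, pderiv1_schwartz i η⟩) γ (g := ⇑φ) (h := ⇑φ) ⟨φ, rfl⟩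
  exact this

lemma schwartz_bdd {n : ℕ} (N : ℕ) (η : SchwartzMap (Rn n) ℝ) :
    ∃ B : ℝ, 0 < B ∧ ∀ x, (1 + ‖x‖) ^ N * |η x| ≤ B := by
  refine ⟨max 1 (2 ^ N * (Finset.Iic (N, 0)).sup (fun m => SchwartzMap.seminorm ℝ m.1 m.2) η),
    by positivity, fun x => ?_⟩
  have := SchwartzMap.one_add_le_sup_seminorm_apply (𝕜 := ℝ) (m := (N, 0)) (k := N) (n := 0)
    le_rfl le_rfl η x
  rw [norm_iteratedFDeriv_zero, Real.norm_eq_abs] at this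
  exact this.trans (le_max_right _ _)

/-- Uniform control of the first `N` weighted derivatives. -/
def HasB {n : ℕ} (N : ℕ) (B : ℝ) (Θ : Rn n → ℝ) : Prop :=
  ∀ γ ∈ multiIndices n N, ∀ x, (1 + ‖x‖) ^ N * |mderiv γ Θ x| ≤ B

lemma hasB_of_FN {n N : ℕ} {φ : SchwartzMap (Rn n) ℝ} (h : φ ∈ FN n N) : HasB N 1 (⇑φ) := by
  intro γ hγ x
  obtain ⟨η, hη⟩ := mderiv_schwartz γ φ
  obtain ⟨B, hB, hb⟩ := schwartz_bdd N η
  have h1 : (1 + ‖x‖) ^ N * |mderiv γ (⇑φ) x| ≤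
      ⨆ x : Rn n, (1 + ‖x‖) ^ N * |mderiv γ (⇑φ) x| := by
    refine le_ciSup (f := fun x : Rn n => (1 + ‖x‖) ^ N * |mderiv γ (⇑φ) x|) ⟨B, ?_⟩ x
    rintro _ ⟨y, rfl⟩
    simp only [hη]
    exact hb y
  have h2 : (⨆ x : Rn n, (1 + ‖x‖) ^ N * |mderiv γ (⇑φ) x|) ≤
      ∑ γ ∈ multiIndices n N, ⨆ x : Rn n, (1 + ‖x‖) ^ N * |mderiv γ (⇑φ) x| :=
    Finset.single_le_sum
      (f := fun γ => ⨆ x : Rn n, (1 + ‖x‖) ^ N * |mderiv γ (⇑φ) x|)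
      (fun γ _ => Real.iSup_nonneg fun x => by positivity) hγ
  exact h1.trans (h2.trans h)

lemma exists_hasB {n : ℕ} (N : ℕ) (φ : SchwartzMap (Rn n) ℝ) : ∃ B > 0, HasB N B (⇑φ) := by
  have : ∀ γ : Fin n → ℕ, ∃ B : ℝ, 0 < B ∧ ∀ x, (1 + ‖x‖) ^ N * |mderiv γ (⇑φ) x| ≤ B := by
    intro γ
    obtain ⟨η, hη⟩ := mderiv_schwartz γ φ
    rw [hη]
    exact schwartz_bdd N η
  choose B hB hb using this
  refine ⟨1 + ∑ γ ∈ multiIndices n N, B γ, ?_, fun γ hγ x => (hb γ x).trans ?_⟩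
  · have := Finset.sum_nonneg (s := multiIndices n N) (fun γ _ => (hB γ).le)
    linarith
  · have := Finset.single_le_sum (f := B) (fun γ _ => (hB γ).le) hγ
    linarith

lemma zero_mem_multiIndices (n N : ℕ) : (0 : Fin n → ℕ) ∈ multiIndices n N := by
  simp [multiIndices]

lemma mderiv_zero {n : ℕ} (g : Rn n → ℝ) : mderiv 0 g = g := by
  unfold mderiv
  induction (List.finRange n) with
  | nil => rfl
  | cons i l ih => simp [ih]

lemma hasB_zero {n N : ℕ} {B : ℝ} {Θ : Rn n → ℝ} (h : HasB N B Θ) (x : Rn n) :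
    (1 + ‖x‖) ^ N * |Θ x| ≤ B := by
  have := h 0 (zero_mem_multiIndices n N) x
  rwa [mderiv_zero] at this

lemma mderiv_translate {n : ℕ} (γ : Fin n → ℕ) (g : Rn n → ℝ) (a : Rn n) :
    mderiv γ (fun x => g (x + a)) = fun x => mderiv γ g (x + a) := by
  refine mderiv_rel (fun g h => g = fun x => h (x + a)) ?_ γ rfl
  rintro i g h rfl
  ext x
  simp [pderiv1, fderiv_comp_add_right]

lemma mderiv_smul {n : ℕ} (γ : Fin n → ℕ) (φ : SchwartzMap (Rn n) ℝ) (c : ℝ) :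
    mderiv γ (⇑(c • φ)) = fun x => c * mderiv γ (⇑φ) x := by
  have := mderiv_rel (fun g h => ∃ η : SchwartzMap (Rn n) ℝ, h = ⇑η ∧ g = ⇑(c • η)) ?_ γ
    (g := ⇑(c • φ)) (h := ⇑φ) ⟨φ, rfl, rfl⟩
  · obtain ⟨η, h1, h2⟩ := this
    rw [h1, h2]; rfl
  · rintro i g h ⟨η, rfl, rfl⟩
    refine ⟨_, pderiv1_schwartz i η, ?_⟩
    rw [pderiv1_schwartz, map_smul]

lemma hasB_translate {n N : ℕ} {B A : ℝ} {Θ : Rn n → ℝ} (h : HasB N B Θ) (hA : 0 ≤ A)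
    (a : Rn n) (ha : ‖a‖ ≤ A) : HasB N ((1 + A) ^ N * B) (fun x => Θ (x + a)) := by
  intro γ hγ x
  rw [mderiv_translate]
  have h1 := h γ hγ (x + a)
  have h2 : 1 + ‖x‖ ≤ (1 + A) * (1 + ‖x + a‖) := by
    have : ‖x‖ ≤ ‖x + a‖ + ‖a‖ := by
      have := norm_sub_le (x + a) a
      simpa using this
    nlinarith [norm_nonneg (x + a), norm_nonneg a]
  calc (1 + ‖x‖) ^ N * |mderiv γ Θ (x + a)|
      ≤ ((1 + A) * (1 + ‖x + a‖)) ^ N * |mderiv γ Θ (x + a)| := by gcongr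
    _ = (1 + A) ^ N * ((1 + ‖x + a‖) ^ N * |mderiv γ Θ (x + a)|) := by rw [mul_pow]; ring
    _ ≤ _ := by gcongr

/-- The number of multi-indices. -/
noncomputable def cardM (n N : ℕ) : ℝ := (multiIndices n N).card

lemma cardM_pos (n N : ℕ) : 0 < cardM n N := by
  unfold cardM
  exact_mod_cast Finset.card_pos.mpr ⟨0, zero_mem_multiIndices n N⟩

lemma gm_bound {n N : ℕ} {B : ℝ} (hB : 0 < B) (Θ : SchwartzMap (Rn n) ℝ) (h : HasB N B (⇑Θ))
    (f : Rn n → ℝ) (w : Rn n) {σ : ℝ} (hσ : 0 < σ) :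
    ENNReal.ofReal |∫ y, σ ^ (-(n : ℝ)) * Θ (σ⁻¹ • (w - y)) * f y| ≤
      ENNReal.ofReal (B * cardM n N) * grandMax n N f w := by
  have hc := cardM_pos n N
  set K := B * cardM n N with hK
  have hK0 : 0 < K := by positivity
  have hmem : K⁻¹ • Θ ∈ FN n N := by
    show (∑ γ ∈ multiIndices n N, ⨆ x : Rn n, (1 + ‖x‖) ^ N * |mderiv γ (⇑(K⁻¹ • Θ)) x|) ≤ 1
    have : ∀ γ ∈ multiIndices n N,
        (⨆ x : Rn n, (1 + ‖x‖) ^ N * |mderiv γ (⇑(K⁻¹ • Θ)) x|) ≤ (cardM n N)⁻¹ := by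
      intro γ hγ
      refine ciSup_le fun x => ?_
      rw [mderiv_smul, abs_mul, abs_of_pos (inv_pos.mpr hK0)]
      have := h γ hγ x
      calc (1 + ‖x‖) ^ N * (K⁻¹ * |mderiv γ (⇑Θ) x|)
          = K⁻¹ * ((1 + ‖x‖) ^ N * |mderiv γ (⇑Θ) x|) := by ring
        _ ≤ K⁻¹ * B := by gcongr
        _ = (cardM n N)⁻¹ := by rw [hK]; field_simp
    refine (Finset.sum_le_sum this).trans ?_
    rw [Finset.sum_const, nsmul_eq_mul]
    exact (mul_inv_cancel₀ hc.ne').le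
  have h1 : ENNReal.ofReal |∫ y, σ ^ (-(n : ℝ)) * (K⁻¹ • Θ) (σ⁻¹ • (w - y)) * f y| ≤
      grandMax n N f w := by
    unfold grandMax
    exact le_iSup₂_of_le σ hσ (le_iSup_of_le ⟨K⁻¹ • Θ, hmem⟩ le_rfl)
  have h2 : (∫ y, σ ^ (-(n : ℝ)) * Θ (σ⁻¹ • (w - y)) * f y) =
      K * ∫ y, σ ^ (-(n : ℝ)) * (K⁻¹ • Θ) (σ⁻¹ • (w - y)) * f y := by
    rw [← integral_const_mul]
    congr 1; ext y
    simp only [smul_apply, smul_eq_mul]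
    field_simp
  rw [h2, abs_mul, abs_of_pos hK0, ENNReal.ofReal_mul hK0.le]
  gcongr

/-- Version of `gm_bound` with a shifted centre. -/
lemma gm_bound_shift {n N : ℕ} {B A : ℝ} (hB : 0 < B) (hA : 0 ≤ A) (Θ : SchwartzMap (Rn n) ℝ)
    (h : HasB N B (⇑Θ)) (f : Rn n → ℝ) (x w : Rn n) {σ : ℝ} (hσ : 0 < σ)
    (hxw : ‖x - w‖ ≤ A * σ) :
    ENNReal.ofReal |∫ y, σ ^ (-(n : ℝ)) * Θ (σ⁻¹ • (x - y)) * f y| ≤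
      ENNReal.ofReal ((1 + A) ^ N * B * cardM n N) * grandMax n N f w := by
  have ha : ‖σ⁻¹ • (x - w)‖ ≤ A := by
    rw [norm_smul, Real.norm_eq_abs, abs_of_pos (inv_pos.mpr hσ), inv_mul_le_iff₀ hσ]
    linarith
  have h1 := hasB_translate h hA _ ha
  have h2 := gm_bound (B := (1 + A) ^ N * B) (by positivity)
    (SchwartzMap.compSubConstCLM ℝ (-(σ⁻¹ • (x - w))) Θ) (N := N) (by
      convert h1 using 2
      simp) f w hσ
  convert h2 using 6 with y
  simp only [SchwartzMap.compSubConstCLM_apply, sub_neg_eq_add, ← smul_add]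
  congr 4
  abel


/-- A radial bump function. -/
noncomputable def bump (n : ℕ) : Rn n → ℝ := fun v => Real.smoothTransition (1 - ‖v‖ ^ 2)

lemma bump_nonneg {n : ℕ} (v : Rn n) : 0 ≤ bump n v := Real.smoothTransition.nonneg _
lemma bump_le_one {n : ℕ} (v : Rn n) : bump n v ≤ 1 := Real.smoothTransition.le_one _
lemma bump_eq_zero {n : ℕ} {v : Rn n} (h : 1 ≤ ‖v‖) : bump n v = 0 :=
  Real.smoothTransition.zero_of_nonpos (by nlinarith)
lemma bump_pos {n : ℕ} {v : Rn n} (h : ‖v‖ < 1) : 0 < bump n v :=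
  Real.smoothTransition.pos_of_pos (by nlinarith [norm_nonneg v])

lemma bump_contDiff (n : ℕ) : ContDiff ℝ (⊤ : ℕ∞) (bump n) :=
  Real.smoothTransition.contDiff.comp (contDiff_const.sub (contDiff_norm_sq ℝ))

lemma bump_continuous (n : ℕ) : Continuous (bump n) := (bump_contDiff n).continuous

lemma bump_tsupport (n : ℕ) : tsupport (bump n) ⊆ Metric.closedBall 0 1 := by
  refine closure_minimal ?_ Metric.isClosed_closedBall
  intro v hv
  rw [mem_closedBall_zero_iff]
  by_contra h
  exact hv (bump_eq_zero (by linarith))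

lemma bump_compact (n : ℕ) : HasCompactSupport (bump n) :=
  HasCompactSupport.of_support_subset_isCompact (isCompact_closedBall 0 1)
    ((subset_tsupport _).trans (bump_tsupport n))

/-- The bump as Schwartz function. -/
noncomputable def bumpS (n : ℕ) : SchwartzMap (Rn n) ℝ :=
  (bump_compact n).toSchwartzMap (bump_contDiff n)

lemma coe_bumpS (n : ℕ) : ⇑(bumpS n) = bump n := rfl

open Convolution in
lemma exists_conv {n : ℕ} (ψ φ : SchwartzMap (Rn n) ℝ) :
    ∃ Φ : SchwartzMap (Rn n) ℝ, ∀ v, Φ v = (⇑ψ ⋆[ContinuousLinearMap.mul ℝ ℝ] ⇑φ) v := by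
  refine ⟨SchwartzMap.postcompCLM (𝕜 := ℝ) Complex.reCLM (SchwartzMap.convolution (𝕜 := ℂ)
    (ContinuousLinearMap.mul ℂ ℂ) (SchwartzMap.postcompCLM (𝕜 := ℝ) Complex.ofRealCLM ψ)
    (SchwartzMap.postcompCLM (𝕜 := ℝ) Complex.ofRealCLM φ)), fun v => ?_⟩
  rw [SchwartzMap.postcompCLM_apply, SchwartzMap.convolution_apply]
  simp only [convolution_def, SchwartzMap.postcompCLM_apply, ContinuousLinearMap.mul_apply',
    Complex.reCLM_apply, Complex.ofRealCLM_apply]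
  simp_rw [← Complex.ofReal_mul]
  rw [integral_complex_ofReal, Complex.ofReal_re]

open Convolution in
lemma mderiv_conv {n : ℕ} (γ : Fin n → ℕ) (ψ : SchwartzMap (Rn n) ℝ) :
    (∀ v, 1 < ‖v‖ → mderiv γ (bump n) v = 0) ∧
    mderiv γ (⇑ψ ⋆[ContinuousLinearMap.mul ℝ ℝ] bump n) =
      (⇑ψ ⋆[ContinuousLinearMap.mul ℝ ℝ] mderiv γ (bump n)) := by
  have := mderiv_rel (fun g h => ContDiff ℝ (⊤ : ℕ∞) h ∧ tsupport h ⊆ Metric.closedBall 0 1 ∧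
    g = (⇑ψ ⋆[ContinuousLinearMap.mul ℝ ℝ] h)) ?_ γ
    (g := (⇑ψ ⋆[ContinuousLinearMap.mul ℝ ℝ] bump n)) (h := bump n)
    ⟨bump_contDiff n, bump_tsupport n, rfl⟩
  · refine ⟨fun v hv => ?_, this.2.2⟩
    by_contra h
    have := this.2.1 (subset_tsupport _ h)
    rw [mem_closedBall_zero_iff] at this
    linarith
  · rintro i g h ⟨h1, h2, rfl⟩
    have hc : HasCompactSupport h := HasCompactSupport.of_support_subset_isCompact
      (isCompact_closedBall 0 1) ((subset_tsupport _).trans h2)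
    have hψ : LocallyIntegrable (⇑ψ) (volume : Measure (Rn n)) := ψ.continuous.locallyIntegrable
    refine ⟨?_, ?_, ?_⟩
    · unfold pderiv1
      exact (h1.fderiv_right (m := (⊤ : ℕ∞)) (by simp)).clm_apply contDiff_const
    · exact (tsupport_fderiv_apply_subset ℝ _).trans h2
    · ext x
      have h1' : ContDiff ℝ 1 h := h1.of_le (by exact_mod_cast le_top)
      have := hc.hasFDerivAt_convolution_right (ContinuousLinearMap.mul ℝ ℝ) hψ h1' x
      rw [pderiv1, this.fderiv, convolution_precompR_apply _ hψ (hc.fderiv ℝ)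
        (h1'.continuous_fderiv one_ne_zero)]
      rfl

/-- `∫ (1+|u|)^{-N}`. -/
noncomputable def wI (n N : ℕ) : ℝ := ∫ u : Rn n, ((1 + ‖u‖) ^ N)⁻¹

lemma integrable_w {n N : ℕ} (hN : n + 1 ≤ N) :
    Integrable (fun u : Rn n => ((1 + ‖u‖) ^ N)⁻¹) := by
  have := integrable_one_add_norm (E := Rn n) (μ := volume) (r := N) (by
    simp; omega)
  refine this.congr (Filter.Eventually.of_forall fun u => ?_)
  simp only
  rw [Real.rpow_neg (by positivity), Real.rpow_natCast]

lemma wI_nonneg (n N : ℕ) : 0 ≤ wI n N := integral_nonneg fun u => by positivity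

/-- volume of unit ball -/
noncomputable def om (n : ℕ) : ℝ := (volume (Metric.ball (0 : Rn n) 1)).toReal

lemma om_pos (n : ℕ) : 0 < om n :=
  ENNReal.toReal_pos (Metric.measure_ball_pos _ _ one_pos).ne' measure_ball_lt_top.ne

lemma vol_ball {n : ℕ} (x : Rn n) {r : ℝ} (hr : 0 < r) :
    volume (Metric.ball x r) = ENNReal.ofReal (r ^ n * om n) := by
  rw [Measure.addHaar_ball_of_pos _ _ hr, ENNReal.ofReal_mul (by positivity), om,
    ENNReal.ofReal_toReal measure_ball_lt_top.ne]
  simp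

lemma vol_closedBall {n : ℕ} (x : Rn n) {r : ℝ} (hr : 0 < r) :
    volume (Metric.closedBall x r) = ENNReal.ofReal (r ^ n * om n) := by
  rw [Measure.addHaar_closedBall _ _ hr.le, ENNReal.ofReal_mul (by positivity), om,
    ENNReal.ofReal_toReal measure_ball_lt_top.ne]
  simp

lemma scaled_weight {r a : ℝ} (hr : 0 < r) (hr1 : r ≤ 1) (ha : 0 ≤ a) (N : ℕ) :
    (1 + r * a) ^ N * ((1 + a) ^ N)⁻¹ ≤ 2 ^ N * (r ^ N + ((1 + a) ^ N)⁻¹) := by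
  have h1 : (1 + r * a) ^ N * ((1 + a) ^ N)⁻¹ = ((1 + r * a) / (1 + a)) ^ N := by
    rw [div_pow, div_eq_mul_inv]
  have h2 : (1 + r * a) / (1 + a) ≤ r + (1 + a)⁻¹ := by
    rw [div_le_iff₀ (by positivity), add_mul, inv_mul_cancel₀ (by positivity)]
    nlinarith
  rw [h1]
  calc ((1 + r * a) / (1 + a)) ^ N ≤ (r + (1 + a)⁻¹) ^ N := by gcongr
    _ ≤ 2 ^ (N - 1) * (r ^ N + ((1 + a)⁻¹) ^ N) := add_pow_le hr.le (by positivity) N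
    _ ≤ _ := by
      rw [inv_pow]
      gcongr
      · norm_num
      · omega

lemma conv_scale {n : ℕ} (hn : 0 < n) (ψ : SchwartzMap (Rn n) ℝ) (h : Rn n → ℝ) {r : ℝ} (hr : 0 < r) (v : Rn n) :
    (∫ u, (r ^ n)⁻¹ * ψ (r⁻¹ • u) * h (v - u)) = ∫ u, ψ u * h (v - r • u) := by
  have := Measure.integral_comp_smul (volume : Measure (Rn n))
    (fun u => (r ^ n)⁻¹ * ψ (r⁻¹ • u) * h (v - u)) r
  simp only [inv_smul_smul₀ hr.ne', finrank_euclideanSpace, Fintype.card_fin, smul_eq_mul] at this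
  rw [abs_of_pos (by positivity)] at this
  simp_rw [mul_assoc, integral_const_mul] at this
  have h3 : (r ^ n)⁻¹ ≠ 0 := by positivity
  simp_rw [mul_assoc, integral_const_mul]
  exact (mul_left_cancel₀ h3 this).symm

/-- Constant in case B. -/
noncomputable def cB (n N : ℕ) (D : ℝ) : ℝ := D * (4 ^ N * (om n + wI n N))

open Convolution in
lemma conv_hasB {n N : ℕ} (hn : 0 < n) (hN : n + 1 ≤ N) {D : ℝ} (hD : HasB N D (bump n))
    (ψ : SchwartzMap (Rn n) ℝ) (hψ : HasB N 1 (⇑ψ)) {r : ℝ} (hr : 0 < r) (hr1 : r ≤ 1) :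
    ∃ Φ : SchwartzMap (Rn n) ℝ, (∀ v, Φ v = ∫ u, ψ u * bump n (v - r • u)) ∧
      HasB N (cB n N D) (⇑Φ) := by
  have hD0 : 0 ≤ D := le_trans (by positivity) (hasB_zero hD 0)
  let e : Rn n ≃L[ℝ] Rn n := ContinuousLinearEquiv.smulLeft (Units.mk0 r⁻¹ (inv_ne_zero hr.ne'))
  have he : ∀ u, e u = r⁻¹ • u := fun u => rfl
  let ψr : SchwartzMap (Rn n) ℝ :=
    (r ^ n)⁻¹ • SchwartzMap.compCLMOfContinuousLinearEquiv ℝ e ψ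
  have hψr : ∀ u, ψr u = (r ^ n)⁻¹ * ψ (r⁻¹ • u) := fun u => rfl
  obtain ⟨Φ, hΦ⟩ := exists_conv ψr (bumpS n)
  have key : ∀ (h : Rn n → ℝ) v, (⇑ψr ⋆[ContinuousLinearMap.mul ℝ ℝ] h) v =
      ∫ u, ψ u * h (v - r • u) := by
    intro h v
    rw [← conv_scale hn ψ h hr v]
    rfl
  refine ⟨Φ, fun v => by rw [hΦ, key]; rfl, ?_⟩
  have hΦ' : ⇑Φ = (⇑ψr ⋆[ContinuousLinearMap.mul ℝ ℝ] bump n) := funext hΦ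
  intro γ hγ v
  obtain ⟨hs, hm⟩ := mderiv_conv γ ψr
  rw [hΦ', hm, key]
  have hball : ∀ u : Rn n, ‖v - r • u‖ ≤ 1 → u ∈ Metric.closedBall (r⁻¹ • v) r⁻¹ := by
    intro u hu
    rw [mem_closedBall_iff_norm, norm_sub_rev]
    have : r⁻¹ • v - u = r⁻¹ • (v - r • u) := by rw [smul_sub, inv_smul_smul₀ hr.ne']
    rw [this, norm_smul, Real.norm_eq_abs, abs_of_pos (inv_pos.mpr hr)]
    exact mul_le_of_le_one_right (by positivity) hu
  set S := Metric.closedBall (r⁻¹ • v) r⁻¹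
  have hSm : MeasurableSet S := Metric.isClosed_closedBall.measurableSet
  let b : Rn n → ℝ := fun u => D * (4 ^ N * (S.indicator (fun _ => r ^ N) u + ((1 + ‖u‖) ^ N)⁻¹))
  have hSfin : volume S ≠ ⊤ := measure_closedBall_lt_top.ne
  have hi1 : Integrable (S.indicator (fun _ : Rn n => r ^ N)) :=
    (integrable_indicator_iff hSm).2 (integrableOn_const hSfin)
  have hbi : Integrable b := ((hi1.add (integrable_w hN)).const_mul _).const_mul _
  have hpt : ∀ u, ‖(1 + ‖v‖) ^ N * (ψ u * mderiv γ (bump n) (v - r • u))‖ ≤ b u := by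
    intro u
    by_cases hu : ‖v - r • u‖ ≤ 1
    · have hm1 : |mderiv γ (bump n) (v - r • u)| ≤ D := by
        have h0 := hD γ hγ (v - r • u)
        have h1 : (1:ℝ) ≤ (1 + ‖v - r • u‖) ^ N := one_le_pow₀ (by linarith [norm_nonneg (v - r • u)])
        nlinarith [abs_nonneg (mderiv γ (bump n) (v - r • u))]
      have hp1 : |ψ u| ≤ ((1 + ‖u‖) ^ N)⁻¹ := by
        have h0 := hasB_zero hψ u
        rw [← mul_le_mul_iff_right₀ (show 0 < (1 + ‖u‖) ^ N by positivity),
          mul_inv_cancel₀ (by positivity)]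
        exact h0
      have hv : 1 + ‖v‖ ≤ 2 * (1 + r * ‖u‖) := by
        have : ‖v‖ ≤ ‖v - r • u‖ + ‖r • u‖ := by
          have := norm_add_le (v - r • u) (r • u)
          simpa using this
        rw [norm_smul, Real.norm_eq_abs, abs_of_pos hr] at this
        nlinarith [norm_nonneg u]
      rw [Real.norm_eq_abs, abs_mul, abs_mul, abs_of_nonneg (by positivity)]
      have hind : S.indicator (fun _ => r ^ N) u = r ^ N := Set.indicator_of_mem (hball u hu) _
      simp only [b, hind]
      calc (1 + ‖v‖) ^ N * (|ψ u| * |mderiv γ (bump n) (v - r • u)|)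
          ≤ (2 * (1 + r * ‖u‖)) ^ N * (((1 + ‖u‖) ^ N)⁻¹ * D) := by gcongr
        _ = D * (2 ^ N * ((1 + r * ‖u‖) ^ N * ((1 + ‖u‖) ^ N)⁻¹)) := by rw [mul_pow]; ring
        _ ≤ D * (2 ^ N * (2 ^ N * (r ^ N + ((1 + ‖u‖) ^ N)⁻¹))) := by
          exact mul_le_mul_of_nonneg_left (mul_le_mul_of_nonneg_left
            (scaled_weight hr hr1 (norm_nonneg u) N) (by positivity)) hD0
        _ = _ := by
          rw [show (4:ℝ) = 2 * 2 by norm_num, mul_pow]; ring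
    · rw [hs _ (not_le.mp hu)]
      simp only [mul_zero, norm_zero]
      have : 0 ≤ S.indicator (fun _ => r ^ N) u := Set.indicator_nonneg (fun _ _ => by positivity) _
      positivity
  have h1 := norm_integral_le_of_norm_le hbi (Filter.Eventually.of_forall hpt)
  rw [integral_const_mul, Real.norm_eq_abs, abs_mul, abs_of_nonneg (by positivity)] at h1
  refine h1.trans ?_
  simp only [b]
  rw [integral_const_mul, integral_const_mul, integral_add hi1 (integrable_w hN),
    integral_indicator_const _ hSm]
  unfold cB wI
  gcongr
  rw [measureReal_def, vol_closedBall _ (inv_pos.mpr hr),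
    ENNReal.toReal_ofReal (by have := om_pos n; positivity), smul_eq_mul]
  have h2 : r⁻¹ ^ n * om n * r ^ N = om n * r ^ (N - n) := by
    have : r ^ N = r ^ n * r ^ (N - n) := by rw [← pow_add]; congr 1; omega
    rw [this, inv_pow]
    field_simp
  rw [h2]
  exact mul_le_of_le_one_right (om_pos n).le (pow_le_one₀ hr.le hr1)


lemma cv1 {n : ℕ} (hn : 0 < n) (ψ : SchwartzMap (Rn n) ℝ) (h : Rn n → ℝ) {s : ℝ} (hs : 0 < s)
    (x : Rn n) :
    (∫ y, s ^ (-(n:ℝ)) * ψ (s⁻¹ • (x - y)) * h y) = ∫ u, ψ u * h (x - s • u) := by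
  rw [← conv_scale hn ψ h hs x, ← integral_sub_left_eq_self
    (fun y => s ^ (-(n:ℝ)) * ψ (s⁻¹ • (x - y)) * h y) volume x]
  congr 1; ext u
  simp only [_root_.sub_sub_cancel]
  rw [Real.rpow_neg hs.le, Real.rpow_natCast]

lemma cv2 {n : ℕ} (hn : 0 < n) (k : Rn n → ℝ) {t : ℝ} (ht : 0 < t) (z : Rn n) :
    (∫ y, k y * (t ^ (-(n:ℝ)) * bump n (t⁻¹ • (y - z)))) = ∫ u, bump n u * k (z + t • u) := by
  have := conv_scale hn (bumpS n) (fun w => k (-w)) ht (-z)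
  simp only [coe_bumpS, neg_sub, sub_neg_eq_add] at this
  rw [← integral_add_right_eq_self _ z]
  simp only [add_sub_cancel_right]
  simp_rw [add_comm z]
  rw [← this]
  congr 1; ext u
  rw [Real.rpow_neg ht.le, Real.rpow_natCast]
  ring

/-- The doubly smoothed distribution. -/
noncomputable def HH {n : ℕ} (f : Rn n → ℝ) (ψ : SchwartzMap (Rn n) ℝ) (x : Rn n) (s t : ℝ) : ℝ :=
  ∫ z, (∫ y, (s ^ (-(n:ℝ)) * ψ (s⁻¹ • (x - y))) * (t ^ (-(n:ℝ)) * bump n (t⁻¹ • (y - z)))) * f z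

lemma HH_caseB {n N : ℕ} (hn : 0 < n) (hN : n + 1 ≤ N) {D : ℝ} (hD0 : 0 < D)
    (hD : HasB N D (bump n)) (f : Rn n → ℝ) (ψ : SchwartzMap (Rn n) ℝ) (hψ : HasB N 1 (⇑ψ))
    (x w : Rn n) {s t : ℝ} (hs : 0 < s) (hst : s ≤ t) (hw : ‖x - w‖ ≤ t) :
    ENNReal.ofReal |HH f ψ x s t| ≤
      ENNReal.ofReal (2 ^ N * cB n N D * cardM n N) * grandMax n N f w := by
  have ht : 0 < t := hs.trans_le hst
  obtain ⟨Φ, hΦ, hB⟩ := conv_hasB hn hN hD ψ hψ (r := s / t) (by positivity)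
    (by rw [div_le_one ht]; exact hst)
  have hcB : 0 < cB n N D := by
    unfold cB
    have := om_pos n; have := wI_nonneg n N
    positivity
  have h := gm_bound_shift hcB zero_le_one Φ hB f x w ht (by linarith)
  have e : HH f ψ x s t = ∫ y, t ^ (-(n : ℝ)) * Φ (t⁻¹ • (x - y)) * f y := by
    unfold HH
    congr 1; ext z
    congr 1
    rw [cv1 hn ψ _ hs x, hΦ, ← integral_const_mul]
    congr 1; ext u
    have : t⁻¹ • (x - s • u - z) = t⁻¹ • (x - z) - (s / t) • u := by
      rw [sub_right_comm, smul_sub, smul_smul]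
      congr 2
      field_simp
    rw [this]; ring
  rw [e]
  convert h using 4
  norm_num

lemma integrable_bump (n : ℕ) : Integrable (bump n) :=
  (bump_continuous n).integrable_of_hasCompactSupport (bump_compact n)

lemma integral_bump_le (n : ℕ) : ∫ u, bump n u ≤ om n := by
  have h : ∀ u, bump n u ≤ (Metric.ball (0 : Rn n) 1).indicator (fun _ => (1:ℝ)) u := by
    intro u
    by_cases hu : ‖u‖ < 1
    · rw [Set.indicator_of_mem (by simpa using hu)]; exact bump_le_one u
    · rw [bump_eq_zero (not_lt.mp hu)]
      exact Set.indicator_nonneg (fun _ _ => zero_le_one) _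
  have h2 := integral_mono (integrable_bump n) ((integrable_indicator_iff
    Metric.isOpen_ball.measurableSet).2 (integrableOn_const measure_ball_lt_top.ne)) h
  rw [integral_indicator_const _ Metric.isOpen_ball.measurableSet] at h2
  simpa [om, measureReal_def] using h2

lemma weight_shift {n : ℕ} (x z a : Rn n) {s : ℝ} (hs : 0 < s) (ha : ‖a‖ ≤ s) :
    1 + ‖z‖ ≤ (2 + ‖x‖ + 2 * s) * (1 + ‖s⁻¹ • (x - (z + a))‖) := by
  rw [norm_smul, Real.norm_eq_abs, abs_of_pos (inv_pos.mpr hs)]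
  set d := ‖x - (z + a)‖ with hd
  have h1 : ‖z‖ ≤ ‖x‖ + d + ‖a‖ := by
    have : z = x - (x - (z + a)) - a := by abel
    calc ‖z‖ = ‖x - (x - (z + a)) - a‖ := by rw [← this]
      _ ≤ ‖x - (x - (z + a))‖ + ‖a‖ := norm_sub_le _ _
      _ ≤ ‖x‖ + d + ‖a‖ := by gcongr; exact norm_sub_le _ _
  have h2 : d = s * (s⁻¹ * d) := by field_simp
  have h3 : 0 ≤ s⁻¹ * d := by positivity
  nlinarith [norm_nonneg x]

lemma HH_caseA {n N : ℕ} (hn : 0 < n) (f : Rn n → ℝ) (hfm : Measurable f)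
    (hf : Integrable (fun z => ((1 + ‖z‖) ^ N)⁻¹ * f z))
    (ψ : SchwartzMap (Rn n) ℝ) (hψ : HasB N 1 (⇑ψ))
    (x w : Rn n) {s t : ℝ} (ht : 0 < t) (hst : t ≤ s) (hw : ‖x - w‖ ≤ t) :
    ENNReal.ofReal |HH f ψ x s t| ≤
      ENNReal.ofReal (3 ^ N * cardM n N * om n) * grandMax n N f w := by
  have hs : 0 < s := ht.trans_le hst
  have hc := cardM_pos n N
  have ho := om_pos n
  by_cases htop : grandMax n N f w = ⊤
  · rw [htop, ENNReal.mul_top]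
    · exact le_top
    · simp only [ne_eq, ENNReal.ofReal_eq_zero, not_le]; positivity
  have e1 : HH f ψ x s t =
      ∫ z, ∫ u, bump n u * (s ^ (-(n:ℝ)) * ψ (s⁻¹ • (x - (z + t • u)))) * f z := by
    unfold HH
    congr 1; ext z
    rw [cv2 hn _ ht z, integral_mul_const]
  have hint : Integrable (fun zu : Rn n × Rn n => bump n zu.2 * (s ^ (-(n:ℝ)) *
      ψ (s⁻¹ • (x - (zu.1 + t • zu.2)))) * f zu.1) (volume.prod volume) := by
    have hb := (hf.norm.mul_prod (integrable_bump n)).const_mul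
      (s ^ (-(n:ℝ)) * (2 + ‖x‖ + 2 * s) ^ N)
    refine hb.mono' ?_ (Filter.Eventually.of_forall ?_)
    · refine Measurable.aestronglyMeasurable ?_
      have := (bump_continuous n).measurable
      have := ψ.continuous.measurable
      fun_prop
    · rintro ⟨z, u⟩
      simp only
      by_cases hu : ‖u‖ < 1
      · have h1 := hasB_zero hψ (s⁻¹ • (x - (z + t • u)))
        have htu : ‖t • u‖ ≤ s := by
          rw [norm_smul, Real.norm_eq_abs, abs_of_pos ht]
          nlinarith [norm_nonneg u]
        have h2 := weight_shift x z (t • u) hs htu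
        have h3 : |ψ (s⁻¹ • (x - (z + t • u)))| ≤ (2 + ‖x‖ + 2 * s) ^ N * ((1 + ‖z‖) ^ N)⁻¹ := by
          have h4 : (1 + ‖z‖) ^ N ≤
              (2 + ‖x‖ + 2 * s) ^ N * (1 + ‖s⁻¹ • (x - (z + t • u))‖) ^ N := by
            rw [← mul_pow]; gcongr
          rw [← div_eq_mul_inv, le_div_iff₀ (by positivity)]
          set X := |ψ (s⁻¹ • (x - (z + t • u)))|
          calc X * (1 + ‖z‖) ^ N ≤ X * ((2 + ‖x‖ + 2 * s) ^ N *
                (1 + ‖s⁻¹ • (x - (z + t • u))‖) ^ N) := by gcongr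
            _ = (2 + ‖x‖ + 2 * s) ^ N * ((1 + ‖s⁻¹ • (x - (z + t • u))‖) ^ N * X) := by ring
            _ ≤ (2 + ‖x‖ + 2 * s) ^ N * 1 := by gcongr
            _ = _ := mul_one _
        have hsn : 0 < s ^ (-(n:ℝ)) := Real.rpow_pos_of_pos hs _
        rw [Real.norm_eq_abs, Real.norm_eq_abs, abs_mul, abs_mul, abs_mul, abs_mul,
          abs_of_nonneg (bump_nonneg u), abs_of_pos hsn,
          abs_of_nonneg (show 0 ≤ ((1 + ‖z‖) ^ N)⁻¹ by positivity)]
        have := bump_nonneg u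
        calc bump n u * (s ^ (-(n:ℝ)) * |ψ (s⁻¹ • (x - (z + t • u)))|) * |f z|
            ≤ bump n u * (s ^ (-(n:ℝ)) * ((2 + ‖x‖ + 2 * s) ^ N * ((1 + ‖z‖) ^ N)⁻¹)) * |f z| := by
              gcongr
          _ = _ := by ring
      · rw [bump_eq_zero (not_lt.mp hu)]; simp
  have e2 : HH f ψ x s t =
      ∫ u, bump n u * ∫ z, s ^ (-(n:ℝ)) * ψ (s⁻¹ • ((x - t • u) - z)) * f z := by
    rw [e1, integral_integral_swap hint]
    congr 1; ext u
    rw [← integral_const_mul]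
    congr 1; ext z
    rw [show x - (z + t • u) = x - t • u - z by abel]
    ring
  set M := (grandMax n N f w).toReal with hM
  have hMe : grandMax n N f w = ENNReal.ofReal M := (ENNReal.ofReal_toReal htop).symm
  have hM0 : 0 ≤ M := ENNReal.toReal_nonneg
  have hpt : ∀ u, ‖bump n u * ∫ z, s ^ (-(n:ℝ)) * ψ (s⁻¹ • ((x - t • u) - z)) * f z‖ ≤
      bump n u * (3 ^ N * cardM n N * M) := by
    intro u
    by_cases hu : ‖u‖ < 1
    · have htu : ‖t • u‖ ≤ t := by
        rw [norm_smul, Real.norm_eq_abs, abs_of_pos ht]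
        nlinarith [norm_nonneg u]
      have := gm_bound_shift one_pos zero_le_two ψ hψ f (x - t • u) w hs (by
        calc ‖x - t • u - w‖ = ‖(x - w) - t • u‖ := by congr 1; abel
          _ ≤ ‖x - w‖ + ‖t • u‖ := norm_sub_le _ _
          _ ≤ 2 * s := by linarith)
      rw [hMe, ← ENNReal.ofReal_mul (by positivity), ENNReal.ofReal_le_ofReal_iff (by positivity)]
        at this
      rw [Real.norm_eq_abs, abs_mul, abs_of_nonneg (bump_nonneg u)]
      refine mul_le_mul_of_nonneg_left (this.trans (le_of_eq ?_)) (bump_nonneg u)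
      norm_num
    · rw [bump_eq_zero (not_lt.mp hu)]; simp
  have h1 := norm_integral_le_of_norm_le ((integrable_bump n).mul_const _)
    (Filter.Eventually.of_forall hpt)
  rw [← e2, integral_mul_const, Real.norm_eq_abs] at h1
  rw [hMe, ← ENNReal.ofReal_mul (by positivity)]
  refine ENNReal.ofReal_le_ofReal (h1.trans ?_)
  calc (∫ u, bump n u) * (3 ^ N * cardM n N * M) ≤ om n * (3 ^ N * cardM n N * M) := by
        gcongr
        exact integral_bump_le n
    _ = _ := by ring

lemma HH_bound {n : ℕ} (hn : 0 < n) (N : ℕ) (hN : n + 1 ≤ N) : ∃ C > 0,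
    ∀ f : Rn n → ℝ, Measurable f → Integrable (fun z => ((1 + ‖z‖) ^ N)⁻¹ * f z) →
    ∀ ψ : SchwartzMap (Rn n) ℝ, ψ ∈ FN n N → ∀ (x w : Rn n) (s t : ℝ), 0 < s → 0 < t →
    ‖x - w‖ ≤ t → ENNReal.ofReal |HH f ψ x s t| ≤ ENNReal.ofReal C * grandMax n N f w := by
  obtain ⟨D, hD0, hD⟩ := exists_hasB N (bumpS n)
  rw [coe_bumpS] at hD
  have hcB : 0 < cB n N D := by
    unfold cB
    have := om_pos n; have := wI_nonneg n N
    positivity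
  have hc := cardM_pos n N
  have ho := om_pos n
  refine ⟨3 ^ N * cardM n N * om n + 2 ^ N * cB n N D * cardM n N, by positivity, ?_⟩
  intro f hfm hf ψ hψ x w s t hs ht hw
  rcases le_total t s with h | h
  · refine (HH_caseA hn f hfm hf ψ (hasB_of_FN hψ) x w ht h hw).trans ?_
    gcongr
    have : 0 < 2 ^ N * cB n N D * cardM n N := by positivity
    linarith
  · refine (HH_caseB hn hN hD0 hD f ψ (hasB_of_FN hψ) x w hs h hw).trans ?_
    gcongr
    have : 0 < 3 ^ N * cardM n N * om n := by positivity
    linarith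


/-- one dimensional profile -/
noncomputable def kf (n : ℕ) (α : ℝ) (t : ℝ) : ℝ :=
  t ^ (α - 1) * (t ^ (-(n:ℝ)) * Real.smoothTransition (1 - (t⁻¹) ^ 2))

lemma kf_meas (n : ℕ) (α : ℝ) : Measurable (kf n α) := by
  unfold kf
  have := Real.smoothTransition.continuous.measurable
  fun_prop

lemma kf_nonneg {n : ℕ} {α t : ℝ} (ht : 0 < t) : 0 ≤ kf n α t := by
  unfold kf
  have := Real.smoothTransition.nonneg (1 - (t⁻¹) ^ 2)
  positivity

lemma kf_int {n : ℕ} {α : ℝ} (hαn : α < n) : IntegrableOn (kf n α) (Set.Ioi 0) := by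
  have h1 : IntegrableOn (fun t : ℝ => t ^ (α - 1 - n)) (Set.Ioi 1) :=
    integrableOn_Ioi_rpow_of_lt (by linarith) one_pos
  have h2 : IntegrableOn (kf n α) (Set.Ioi 1) := by
    refine Integrable.mono' h1 (kf_meas n α).aestronglyMeasurable ?_
    refine (ae_restrict_iff' measurableSet_Ioi).2 (Filter.Eventually.of_forall fun t ht => ?_)
    have ht0 : (0:ℝ) < t := lt_trans one_pos ht
    rw [Real.norm_of_nonneg (kf_nonneg ht0), kf, ← mul_assoc, ← Real.rpow_add ht0, ← sub_eq_add_neg]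
    exact mul_le_of_le_one_right (by positivity) (Real.smoothTransition.le_one _)
  have h3 : IntegrableOn (kf n α) (Set.Ioc 0 1) := by
    refine (integrableOn_zero).congr_fun (fun t ht => ?_) measurableSet_Ioc
    have : 1 - (t⁻¹) ^ 2 ≤ 0 := by
      have : 1 ≤ t⁻¹ := (one_le_inv₀ ht.1).2 ht.2
      nlinarith
    simp only [kf]
    rw [Real.smoothTransition.zero_of_nonpos this]; simp
  rw [← Set.Ioc_union_Ioi_eq_Ioi (zero_le_one' ℝ)]
  exact h3.union h2

noncomputable def c0 (n : ℕ) (α : ℝ) : ℝ := ∫ t in Set.Ioi 0, kf n α t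

lemma c0_pos {n : ℕ} {α : ℝ} (hαn : α < n) : 0 < c0 n α := by
  unfold c0
  rw [setIntegral_pos_iff_support_of_nonneg_ae _ (kf_int hαn)]
  · refine lt_of_lt_of_le ?_ (measure_mono (s := Set.Ioo 1 2) ?_)
    · simp
    · intro t ht
      have ht0 : (0:ℝ) < t := lt_trans one_pos ht.1
      refine ⟨?_, ht0⟩
      have : 0 < 1 - (t⁻¹) ^ 2 := by
        have h1 : t⁻¹ < 1 := inv_lt_one_of_one_lt₀ ht.1
        have h2 : 0 < t⁻¹ := by positivity
        nlinarith
      have := Real.smoothTransition.pos_of_pos this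
      simp only [Function.mem_support, kf]
      positivity
  · exact (ae_restrict_iff' measurableSet_Ioi).2 (Filter.Eventually.of_forall fun t ht => kf_nonneg ht)

lemma kf_eq {n : ℕ} (α : ℝ) (u : Rn n) (hu : u ≠ 0) {t : ℝ} (ht : 0 < t) :
    t ^ (α - 1) * (t ^ (-(n:ℝ)) * bump n (t⁻¹ • u)) =
      ‖u‖ ^ (α - 1 - n) * kf n α (‖u‖⁻¹ * t) := by
  have hr : 0 < ‖u‖ := norm_pos_iff.2 hu
  have e : (‖u‖⁻¹ * t)⁻¹ = ‖t⁻¹ • u‖ := by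
    rw [norm_smul, Real.norm_eq_abs, abs_of_pos (by positivity)]; field_simp
  rw [kf, e, bump, ← mul_assoc, ← mul_assoc, ← mul_assoc, ← Real.rpow_add ht,
    mul_assoc (‖u‖ ^ _), ← Real.rpow_add (by positivity), Real.mul_rpow (by positivity) ht.le,
    Real.inv_rpow hr.le, ← sub_eq_add_neg]
  have : ‖u‖ ^ (α - 1 - n) ≠ 0 := by positivity
  field_simp

lemma sub_int {n : ℕ} {α : ℝ} (hαn : α < n) (u : Rn n) (hu : u ≠ 0) :
    IntegrableOn (fun t : ℝ => t ^ (α - 1) * (t ^ (-(n:ℝ)) * bump n (t⁻¹ • u))) (Set.Ioi 0) := by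
  have hr : 0 < ‖u‖ := norm_pos_iff.2 hu
  have := (integrableOn_Ioi_comp_mul_left_iff (kf n α) 0 (a := ‖u‖⁻¹) (by positivity)).2
    (by simpa using kf_int hαn)
  exact IntegrableOn.congr_fun (this.const_mul (‖u‖ ^ (α - 1 - n)))
    (fun t ht => (kf_eq α u hu ht).symm) measurableSet_Ioi

lemma not_int_rpow {a : ℝ} : ¬ IntegrableOn (fun t : ℝ => t ^ a) (Set.Ioi 0) :=
  not_integrableOn_Ioi_rpow a

lemma sub_eq {n : ℕ} {α : ℝ} (hαn : α < n) (u : Rn n) :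
    ∫ t in Set.Ioi (0:ℝ), t ^ (α - 1) * (t ^ (-(n:ℝ)) * bump n (t⁻¹ • u)) =
      c0 n α * ‖u‖ ^ (α - n) := by
  by_cases hu : u = 0
  · subst hu
    rw [norm_zero, Real.zero_rpow (by linarith), mul_zero]
    apply integral_undef
    intro h
    have hb : 0 < bump n 0 := bump_pos (by simp)
    apply not_int_rpow (a := α - 1 - n)
    refine IntegrableOn.congr_fun (h.const_mul (bump n 0)⁻¹) (fun t ht => ?_) measurableSet_Ioi
    have ht : 0 < t := ht
    simp only [smul_zero]
    rw [sub_eq_add_neg (α - 1), Real.rpow_add ht]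
    field_simp
  have hr : 0 < ‖u‖ := norm_pos_iff.2 hu
  rw [setIntegral_congr_fun measurableSet_Ioi (fun t ht => kf_eq α u hu ht), integral_const_mul,
    integral_comp_mul_left_Ioi (kf n α) 0 (by positivity)]
  rw [mul_zero, smul_eq_mul, inv_inv, ← c0, show α - (n:ℝ) = (α - 1 - n) + 1 by ring,
    Real.rpow_add hr, Real.rpow_one]
  ring

lemma sub_lint {n : ℕ} {α : ℝ} (hαn : α < n) (u : Rn n) (hu : u ≠ 0) :
    ∫⁻ t in Set.Ioi (0:ℝ), ENNReal.ofReal (t ^ (α - 1) * (t ^ (-(n:ℝ)) * bump n (t⁻¹ • u))) =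
      ENNReal.ofReal (c0 n α * ‖u‖ ^ (α - n)) := by
  rw [← sub_eq hαn u, ofReal_integral_eq_lintegral_ofReal (sub_int hαn u hu)]
  refine (ae_restrict_iff' measurableSet_Ioi).2 (Filter.Eventually.of_forall fun t ht => ?_)
  have ht : 0 < t := ht
  have := bump_nonneg (t⁻¹ • u)
  simp only [Pi.zero_apply]
  positivity

lemma ball_lint {n : ℕ} (hn : 0 < n) {α : ℝ} (hα : 0 < α) {ρ : ℝ} (hρ : 0 < ρ) :
    ∫⁻ u : Rn n, ENNReal.ofReal ((Set.Iio ρ).indicator (fun r : ℝ => r ^ (α - n)) ‖u‖) =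
      ENNReal.ofReal (n * om n * (ρ ^ α / α)) := by
  have : Nonempty (Fin n) := ⟨⟨0, hn⟩⟩
  have hfun : ∀ y ∈ Set.Ioi (0:ℝ), y ^ (Module.finrank ℝ (Rn n) - 1) •
      (Set.Iio ρ).indicator (fun r : ℝ => r ^ (α - n)) y =
      (Set.Ioo 0 ρ).indicator (fun r : ℝ => r ^ (α - 1)) y := by
    intro y hy
    have hy : 0 < y := hy
    by_cases h : y < ρ
    · rw [Set.indicator_of_mem (by exact h), Set.indicator_of_mem (by exact ⟨hy, h⟩),
        finrank_euclideanSpace_fin, smul_eq_mul, ← Real.rpow_natCast, ← Real.rpow_add hy]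
      congr 1
      rw [Nat.cast_sub hn]; simp
    · rw [Set.indicator_of_notMem (by simpa using h), Set.indicator_of_notMem (by simp [h])]; simp
  have h0 : IntegrableOn (fun r : ℝ => r ^ (α - 1)) (Set.Ioo 0 ρ) :=
    (intervalIntegral.integrableOn_Ioo_rpow_iff hρ).2 (by linarith)
  have hI : Integrable (fun u : Rn n => (Set.Iio ρ).indicator (fun r : ℝ => r ^ (α - n)) ‖u‖) := by
    rw [integrable_fun_norm_addHaar volume (f := (Set.Iio ρ).indicator (fun r : ℝ => r ^ (α - n)))]
    refine IntegrableOn.congr_fun ?_ (fun y hy => (hfun y hy).symm) measurableSet_Ioi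
    exact ((integrable_indicator_iff measurableSet_Ioo).2 h0).integrableOn
  rw [← ofReal_integral_eq_lintegral_ofReal hI]
  · rw [integral_fun_norm_addHaar volume ((Set.Iio ρ).indicator (fun r : ℝ => r ^ (α - n))),
      setIntegral_congr_fun measurableSet_Ioi hfun, setIntegral_indicator measurableSet_Ioo,
      Set.inter_eq_right.2 (fun y hy => hy.1), ← integral_Ioc_eq_integral_Ioo,
      ← intervalIntegral.integral_of_le hρ.le, integral_rpow (Or.inl (by linarith))]
    rw [finrank_euclideanSpace_fin, smul_eq_mul, nsmul_eq_mul, sub_add_cancel,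
      Real.zero_rpow hα.ne', sub_zero, mul_assoc]
    rfl
  · refine Filter.Eventually.of_forall fun u => ?_
    simp only [Pi.zero_apply, Set.indicator]
    split_ifs <;> positivity

lemma conv_est {n N : ℕ} (hn : 0 < n) (hN : n + 1 ≤ N) {α : ℝ} (hα : 0 < α) (hαn : α < n) :
    ∃ C > 0, ∀ z : Rn n, ∫⁻ y, ENNReal.ofReal (((1 + ‖y‖) ^ N)⁻¹ * ‖y - z‖ ^ (α - n)) ≤
      ENNReal.ofReal (C * (1 + ‖z‖) ^ (α - n)) := by
  have ho := om_pos n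
  have hw := wI_nonneg n N
  have hn' : (0:ℝ) < n := by exact_mod_cast hn
  refine ⟨(n * om n / α + wI n N) * 2 ^ (n - α), by positivity, fun z => ?_⟩
  set ρ := (1 + ‖z‖) / 2 with hρ
  have hρ0 : 0 < ρ := by positivity
  set I : Rn n → ℝ := fun u => (Set.Iio ρ).indicator (fun r : ℝ => r ^ (α - n)) ‖u‖ with hI
  have hI0 : ∀ u, 0 ≤ I u := fun u => by
    simp only [hI, Set.indicator]
    split_ifs <;> positivity
  have hIm : Measurable I := by
    have : Measurable ((Set.Iio ρ).indicator (fun r : ℝ => r ^ (α - n))) :=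
      Measurable.indicator (by fun_prop) measurableSet_Iio
    exact this.comp measurable_norm
  have hpt : ∀ y, ENNReal.ofReal (((1 + ‖y‖) ^ N)⁻¹ * ‖y - z‖ ^ (α - n)) ≤
      ENNReal.ofReal (ρ ^ n)⁻¹ * ENNReal.ofReal (I (y - z)) +
      ENNReal.ofReal (ρ ^ (α - n)) * ENNReal.ofReal ((1 + ‖y‖) ^ N)⁻¹ := by
    intro y
    rw [← ENNReal.ofReal_mul (by positivity), ← ENNReal.ofReal_mul (by positivity),
      ← ENNReal.ofReal_add (mul_nonneg (by positivity) (hI0 _)) (by positivity)]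
    refine ENNReal.ofReal_le_ofReal ?_
    by_cases h : ‖y - z‖ < ρ
    · have e : I (y - z) = ‖y - z‖ ^ (α - n) := by
        simp only [hI]; rw [Set.indicator_of_mem (by exact h)]
      rw [e]
      have h1 : ρ ≤ 1 + ‖y‖ := by
        have := norm_sub_norm_le z y
        rw [norm_sub_rev] at this
        linarith
      have h2 : ρ ^ n ≤ (1 + ‖y‖) ^ N := by
        calc ρ ^ n ≤ (1 + ‖y‖) ^ n := by gcongr
          _ ≤ _ := pow_le_pow_right₀ (by linarith [norm_nonneg y]) (by omega)
      have h3 : ((1 + ‖y‖) ^ N)⁻¹ ≤ (ρ ^ n)⁻¹ := by gcongr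
      have h4 : 0 ≤ ρ ^ (α - n) * ((1 + ‖y‖) ^ N)⁻¹ := by positivity
      have h5 : ((1 + ‖y‖) ^ N)⁻¹ * ‖y - z‖ ^ (α - n) ≤ (ρ ^ n)⁻¹ * ‖y - z‖ ^ (α - n) := by gcongr
      linarith
    · have h1 : ‖y - z‖ ^ (α - n) ≤ ρ ^ (α - n) :=
        Real.rpow_le_rpow_of_nonpos hρ0 (not_lt.mp h) (by linarith)
      have h2 : 0 ≤ (ρ ^ n)⁻¹ * I (y - z) := mul_nonneg (by positivity) (hI0 _)
      have h5 : ((1 + ‖y‖) ^ N)⁻¹ * ‖y - z‖ ^ (α - n) ≤ ((1 + ‖y‖) ^ N)⁻¹ * ρ ^ (α - n) := by gcongr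
      linarith
  refine (lintegral_mono hpt).trans ?_
  rw [lintegral_add_left (by fun_prop), lintegral_const_mul _ (by fun_prop),
    lintegral_const_mul _ (by fun_prop),
    lintegral_sub_right_eq_self (fun y => ENNReal.ofReal (I y)) z,
    ball_lint hn hα hρ0, ← ofReal_integral_eq_lintegral_ofReal (integrable_w hN)
      (Filter.Eventually.of_forall fun y => by positivity), ← ENNReal.ofReal_mul (by positivity),
    ← ENNReal.ofReal_mul (by positivity), ← wI,
      ← ENNReal.ofReal_add (by positivity) (by positivity)]
  refine ENNReal.ofReal_le_ofReal (le_of_eq ?_)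
  have e1 : (1 + ‖z‖) ^ (α - n) = ρ ^ (α - n) * 2 ^ (α - n) := by
    rw [← Real.mul_rpow (by positivity) (by positivity)]; congr 1; rw [hρ]; ring
  have e2 : (ρ ^ n)⁻¹ * ρ ^ α = ρ ^ (α - n) := by
    rw [Real.rpow_sub hρ0, Real.rpow_natCast]; field_simp
  have e3 : (2:ℝ) ^ ((n:ℝ) - α) * 2 ^ (α - n) = 1 := by
    rw [← Real.rpow_add two_pos]; simp
  rw [e1]
  calc _ = (n * om n / α) * ((ρ ^ n)⁻¹ * ρ ^ α) + ρ ^ (α - n) * wI n N := by ring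
    _ = (n * om n / α + wI n N) * ρ ^ (α - n) * (2 ^ ((n:ℝ) - α) * 2 ^ (α - n)) := by
      rw [e2, e3]; ring
    _ = _ := by ring


/-- the big integrand -/
noncomputable def FF {n : ℕ} (α : ℝ) (f : Rn n → ℝ) (ψ : SchwartzMap (Rn n) ℝ) (x : Rn n) (s : ℝ)
    (v : (Rn n × Rn n) × ℝ) : ℝ :=
  (s ^ (-(n:ℝ)) * ψ (s⁻¹ • (x - v.1.2)) * f v.1.1) *
    (v.2 ^ (α - 1) * (v.2 ^ (-(n:ℝ)) * bump n (v.2⁻¹ • (v.1.2 - v.1.1))))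

lemma FF_meas {n : ℕ} (α : ℝ) {f : Rn n → ℝ} (hf : Measurable f) (ψ : SchwartzMap (Rn n) ℝ)
    (x : Rn n) (s : ℝ) : Measurable (FF α f ψ x s) := by
  unfold FF
  have h1 := ψ.continuous.measurable
  have h2 := (bump_continuous n).measurable
  have h3 : Measurable fun v : (Rn n × Rn n) × ℝ => v.2⁻¹ • (v.1.2 - v.1.1) := by fun_prop
  have h4 := h2.comp h3
  have h5 := h1.comp (show Measurable fun v : (Rn n × Rn n) × ℝ => s⁻¹ • (x - v.1.2) by fun_prop)
  simp only [Function.comp_def] at h4 h5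
  fun_prop

lemma ae_ne' {n : ℕ} (hn : 0 < n) (z : Rn n) : ∀ᵐ y : Rn n, y - z ≠ 0 := by
  have : Nonempty (Fin n) := ⟨⟨0, hn⟩⟩
  filter_upwards [Measure.ae_ne volume z] with y hy
  exact sub_ne_zero.2 hy

lemma FF_int {n N : ℕ} (hn : 0 < n) (hN : n + 1 ≤ N) {α : ℝ} (hα : 0 < α) (hαn : α < n)
    {f : Rn n → ℝ} (hf : Measurable f) (hI : Integrable (fun z => (1 + ‖z‖) ^ (α - n) * f z))
    {ψ : SchwartzMap (Rn n) ℝ} (hψ : ψ ∈ FN n N) (x : Rn n) {s : ℝ} (hs : 0 < s) :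
    Integrable (FF α f ψ x s)
      ((volume.prod volume).prod (volume.restrict (Set.Ioi 0))) := by
  obtain ⟨C, hC0, hC⟩ := conv_est hn hN hα hαn
  have hc := c0_pos hαn
  have hm := FF_meas α hf ψ x s
  refine ⟨hm.aestronglyMeasurable, ?_⟩
  unfold HasFiniteIntegral
  rw [lintegral_prod _ (by fun_prop), lintegral_prod _ (by
    exact (Measurable.lintegral_prod_right' hm.enorm).aemeasurable)]
  set A : ℝ := s ^ (-(n:ℝ)) * (2 + ‖x‖ + 2 * s) ^ N with hA
  have hA0 : 0 < A := by positivity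
  have hψb : ∀ y, |s ^ (-(n:ℝ)) * ψ (s⁻¹ • (x - y))| ≤ A * ((1 + ‖y‖) ^ N)⁻¹ := by
    intro y
    have h1 := hasB_zero (hasB_of_FN hψ) (s⁻¹ • (x - y))
    have h2 := weight_shift x y 0 hs (by simpa using hs.le)
    rw [add_zero] at h2
    rw [abs_mul, abs_of_pos (by positivity), hA, mul_assoc]
    refine mul_le_mul_of_nonneg_left ?_ (by positivity)
    rw [← div_eq_mul_inv, le_div_iff₀ (by positivity)]
    calc |ψ (s⁻¹ • (x - y))| * (1 + ‖y‖) ^ N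
        ≤ |ψ (s⁻¹ • (x - y))| * ((2 + ‖x‖ + 2 * s) * (1 + ‖s⁻¹ • (x - y)‖)) ^ N := by gcongr
      _ = (2 + ‖x‖ + 2 * s) ^ N * ((1 + ‖s⁻¹ • (x - y)‖) ^ N * |ψ (s⁻¹ • (x - y))|) := by
        rw [mul_pow]; ring
      _ ≤ (2 + ‖x‖ + 2 * s) ^ N * 1 := by gcongr
      _ = _ := mul_one _
  have inner : ∀ z, ∫⁻ y, ∫⁻ t in Set.Ioi (0:ℝ), ‖FF α f ψ x s ((z, y), t)‖ₑ ≤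
      ENNReal.ofReal (A * c0 n α * C) * ‖(1 + ‖z‖) ^ (α - n) * f z‖ₑ := by
    intro z
    have h1 : ∀ᵐ y, ∫⁻ t in Set.Ioi (0:ℝ), ‖FF α f ψ x s ((z, y), t)‖ₑ ≤
        (‖f z‖ₑ * ENNReal.ofReal (A * c0 n α)) *
          ENNReal.ofReal (((1 + ‖y‖) ^ N)⁻¹ * ‖y - z‖ ^ (α - n)) := by
      filter_upwards [ae_ne' hn z] with y hy
      have e : ∫⁻ t in Set.Ioi (0:ℝ), ‖FF α f ψ x s ((z, y), t)‖ₑ =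
          ∫⁻ t in Set.Ioi (0:ℝ), ‖s ^ (-(n:ℝ)) * ψ (s⁻¹ • (x - y)) * f z‖ₑ *
            ENNReal.ofReal (t ^ (α - 1) * (t ^ (-(n:ℝ)) * bump n (t⁻¹ • (y - z)))) := by
        refine setLIntegral_congr_fun measurableSet_Ioi fun t ht => ?_
        have ht : 0 < t := ht
        have := bump_nonneg (t⁻¹ • (y - z))
        simp only [FF, enorm_mul]
        congr 1
        rw [← enorm_mul, ← enorm_mul, Real.enorm_of_nonneg (by positivity)]
      rw [e, lintegral_const_mul' _ _ enorm_ne_top, sub_lint hαn _ hy, enorm_mul,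
        mul_comm _ ‖f z‖ₑ, mul_assoc, mul_assoc, ← ENNReal.ofReal_mul (by positivity)]
      gcongr
      rw [Real.enorm_eq_ofReal_abs, ← ENNReal.ofReal_mul (abs_nonneg _)]
      refine ENNReal.ofReal_le_ofReal ?_
      calc _ ≤ (A * ((1 + ‖y‖) ^ N)⁻¹) * (c0 n α * ‖y - z‖ ^ (α - n)) := by
            gcongr
            exact hψb y
        _ = _ := by ring
    refine (lintegral_mono_ae h1).trans ?_
    rw [lintegral_const_mul _ (by fun_prop)]
    calc _ ≤ (‖f z‖ₑ * ENNReal.ofReal (A * c0 n α)) * ENNReal.ofReal (C * (1 + ‖z‖) ^ (α - n)) := by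
          gcongr; exact hC z
      _ = _ := by
        rw [enorm_mul, Real.enorm_of_nonneg (by positivity : 0 ≤ (1 + ‖z‖) ^ (α - n)),
          ENNReal.ofReal_mul (by positivity : 0 ≤ A * c0 n α), ENNReal.ofReal_mul hC0.le]
        ring
  refine (lintegral_mono inner).trans_lt ?_
  rw [lintegral_const_mul' _ _ ENNReal.ofReal_ne_top]
  exact ENNReal.mul_lt_top ENNReal.ofReal_lt_top hI.2

lemma riesz_HH {n N : ℕ} (hn : 0 < n) (hN : n + 1 ≤ N) {α : ℝ} (hα : 0 < α) (hαn : α < n)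
    {f : Rn n → ℝ} (hf : Measurable f) (hI : Integrable (fun z => (1 + ‖z‖) ^ (α - n) * f z))
    {ψ : SchwartzMap (Rn n) ℝ} (hψ : ψ ∈ FN n N) (x : Rn n) {s : ℝ} (hs : 0 < s) :
    c0 n α * ∫ y, s ^ (-(n:ℝ)) * ψ (s⁻¹ • (x - y)) * riesz α f y =
      ∫ t in Set.Ioi (0:ℝ), t ^ (α - 1) * HH f ψ x s t := by
  have hF := FF_int hn hN hα hαn hf hI hψ x hs
  have e1 : ∫ v, FF α f ψ x s v ∂((volume.prod volume).prod (volume.restrict (Set.Ioi 0))) =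
      c0 n α * ∫ y, s ^ (-(n:ℝ)) * ψ (s⁻¹ • (x - y)) * riesz α f y := by
    rw [integral_prod _ hF, integral_prod_symm _ hF.integral_prod_left, ← integral_const_mul]
    congr 1; ext y
    simp only [FF]
    unfold riesz
    rw [← integral_const_mul, ← integral_const_mul]
    congr 1; ext z
    rw [integral_const_mul, sub_eq hαn]
    ring
  rw [← e1, integral_prod_symm _ hF]
  refine integral_congr_ae ?_
  filter_upwards [hF.prod_left_ae] with t ht
  rw [integral_prod _ ht, HH, ← integral_const_mul]
  congr 1; ext z
  simp only [FF]
  rw [← integral_mul_const, ← integral_const_mul]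
  congr 1; ext y
  ring

lemma riesz_zero {n : ℕ} {α : ℝ} (hn : 0 < n) (hαn : α < n)
    {f : Rn n → ℝ} (hf : Measurable f) (hI : ¬ Integrable (fun z => (1 + ‖z‖) ^ (α - n) * f z))
    (y : Rn n) : riesz α f y = 0 := by
  apply integral_undef
  intro h
  apply hI
  refine Integrable.mono' (h.norm.const_mul ((1 + ‖y‖) ^ (n - α))) (by fun_prop) ?_
  filter_upwards [ae_ne' hn y] with z hz
  have hz' : 0 < ‖y - z‖ := by rw [norm_sub_rev]; exact norm_pos_iff.2 hz
  rw [norm_mul, norm_mul, ← mul_assoc]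
  refine mul_le_mul_of_nonneg_right ?_ (norm_nonneg _)
  rw [Real.norm_of_nonneg (by positivity), Real.norm_of_nonneg (by positivity)]
  have h1 : ‖y - z‖ ≤ (1 + ‖y‖) * (1 + ‖z‖) := by
    have := norm_sub_le y z
    nlinarith [norm_nonneg y, norm_nonneg z]
  have h2 := Real.rpow_le_rpow_of_nonpos hz' h1 (z := α - n) (by linarith)
  rw [Real.mul_rpow (by positivity) (by positivity)] at h2
  have h3 : (1 + ‖y‖) ^ ((n:ℝ) - α) * (1 + ‖y‖) ^ (α - n) = 1 := by
    rw [← Real.rpow_add (by positivity)]; simp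
  calc (1 + ‖z‖) ^ (α - n) = (1 + ‖y‖) ^ ((n:ℝ) - α) * ((1 + ‖y‖) ^ (α - n) * (1 + ‖z‖) ^ (α - n)) := by
        rw [← mul_assoc, h3, one_mul]
    _ ≤ _ := by gcongr

noncomputable def JJ {n : ℕ} (α : ℝ) (g : Rn n → ℝ≥0∞) (x : Rn n) : ℝ≥0∞ :=
  ∫⁻ t in Set.Ioi (0:ℝ), ENNReal.ofReal (t ^ (α - 1)) * ⨅ w : Metric.closedBall x t, g w

lemma grandMax_riesz {n N : ℕ} (hn : 0 < n) (hN : n + 1 ≤ N) {α : ℝ} (hα : 0 < α) (hαn : α < n) :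
    ∃ C > 0, ∀ f : Rn n → ℝ, Measurable f → ∀ x,
      grandMax n N (riesz α f) x ≤ ENNReal.ofReal C * JJ α (grandMax n N f) x := by
  obtain ⟨C, hC0, hC⟩ := HH_bound hn N hN
  have hc := c0_pos hαn
  refine ⟨(c0 n α)⁻¹ * C, by positivity, fun f hf x => ?_⟩
  unfold grandMax
  refine iSup_le fun s => iSup_le fun hs => iSup_le fun ψ => ?_
  obtain ⟨ψ, hψ⟩ := ψ
  by_cases hI : Integrable (fun z => (1 + ‖z‖) ^ (α - n) * f z)
  swap
  · simp [riesz_zero hn hαn hf hI]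
  have hw : Integrable (fun z => ((1 + ‖z‖) ^ N)⁻¹ * f z) := by
    refine Integrable.mono hI (by fun_prop) (Filter.Eventually.of_forall fun z => ?_)
    rw [norm_mul, norm_mul]
    refine mul_le_mul_of_nonneg_right ?_ (norm_nonneg _)
    rw [Real.norm_of_nonneg (by positivity), Real.norm_of_nonneg (by positivity),
      ← Real.rpow_natCast, ← Real.rpow_neg (by positivity)]
    refine Real.rpow_le_rpow_of_exponent_le (by linarith [norm_nonneg z]) ?_
    have : (n:ℝ) + 1 ≤ N := by exact_mod_cast hN
    linarith
  have e := riesz_HH hn hN hα hαn hf hI hψ x hs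
  have e' : ∫ y, s ^ (-(n:ℝ)) * ψ (s⁻¹ • (x - y)) * riesz α f y =
      (c0 n α)⁻¹ * ∫ t in Set.Ioi (0:ℝ), t ^ (α - 1) * HH f ψ x s t := by
    rw [← e]; field_simp
  simp only
  rw [e', abs_mul, abs_of_pos (by positivity), ENNReal.ofReal_mul (by positivity),
    ENNReal.ofReal_mul (by positivity), mul_assoc]
  gcongr
  rw [← Real.enorm_eq_ofReal_abs]
  refine (enorm_integral_le_lintegral_enorm _).trans ?_
  unfold JJ
  rw [← lintegral_const_mul' _ _ ENNReal.ofReal_ne_top]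
  refine setLIntegral_mono' measurableSet_Ioi fun t ht => ?_
  have ht : 0 < t := ht
  rw [enorm_mul, Real.enorm_of_nonneg (by positivity), mul_left_comm]
  gcongr
  rw [ENNReal.mul_iInf_of_ne (by simpa using hC0) ENNReal.ofReal_ne_top]
  refine le_iInf fun w => ?_
  rw [Real.enorm_eq_ofReal_abs]
  have hw' := w.2
  rw [Metric.mem_closedBall, dist_eq_norm, norm_sub_rev] at hw'
  exact hC f hf hw ψ hψ x w s t hs ht hw'


noncomputable def mm {n : ℕ} (g : Rn n → ℝ≥0∞) (x : Rn n) (t : ℝ) : ℝ≥0∞ :=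
  ⨅ w : Metric.closedBall x t, g w

lemma mm_le {n : ℕ} (g : Rn n → ℝ≥0∞) (x w : Rn n) (t : ℝ) (h : dist w x ≤ t) :
    mm g x t ≤ g w := iInf_le (fun w : Metric.closedBall x t => g w) ⟨w, h⟩

lemma V0 {n : ℕ} {p : Rn n → ℝ} (hp : ∀ x, 0 < p x) {g : Rn n → ℝ≥0∞}
    (hg : ∫⁻ x, g x ^ p x ≤ 1) {x z : Rn n} {r t M K : ℝ} (hr : 0 < r) (hM : 0 < M) (hK : 0 < K)
    (hsub : ∀ y ∈ Metric.ball z r, dist y x ≤ t) (h1 : ∀ y ∈ Metric.ball z r, K ≤ M ^ p y)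
    (h2 : 1 < K * (r ^ n * om n)) : mm g x t ≤ ENNReal.ofReal M := by
  by_contra hc
  push Not at hc
  have : ENNReal.ofReal (K * (r ^ n * om n)) ≤ 1 := by
    calc ENNReal.ofReal (K * (r ^ n * om n)) = ENNReal.ofReal K * volume (Metric.ball z r) := by
          rw [vol_ball z hr, ENNReal.ofReal_mul hK.le]
      _ = ∫⁻ y in Metric.ball z r, ENNReal.ofReal K := by rw [setLIntegral_const]
      _ ≤ ∫⁻ y in Metric.ball z r, g y ^ p y := by
          refine setLIntegral_mono' measurableSet_ball fun y hy => ?_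
          calc ENNReal.ofReal K ≤ ENNReal.ofReal (M ^ p y) := ENNReal.ofReal_le_ofReal (h1 y hy)
            _ = ENNReal.ofReal M ^ p y := (ENNReal.ofReal_rpow_of_pos hM).symm
            _ ≤ g y ^ p y := by
              refine ENNReal.rpow_le_rpow ?_ (hp y).le
              exact hc.le.trans (mm_le g x y t (hsub y hy))
      _ ≤ ∫⁻ y, g y ^ p y := setLIntegral_le_lintegral _ _
      _ ≤ 1 := hg
  rw [← ENNReal.ofReal_one, ENNReal.ofReal_le_ofReal_iff one_pos.le] at this
  linarith

lemma exC {pm B : ℝ} (hpm : 0 < pm) (hB : 0 < B) : ∃ C : ℝ, 1 ≤ C ∧ 1 < C ^ pm * B := by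
  refine ⟨(1 + 2 / B) ^ (1 / pm), Real.one_le_rpow ?_ (by positivity), ?_⟩
  · have : 0 < 2 / B := by positivity
    linarith
  · rw [← Real.rpow_mul (by positivity), one_div_mul_cancel hpm.ne', Real.rpow_one]
    field_simp
    linarith

lemma WW {n : ℕ} {pm C t P D py : ℝ} (hpm : 0 < pm) (hC : 1 ≤ C) (ht : 0 < t) (hP : pm ≤ P)
    (hpy : pm ≤ py) (hD : |py - P| * |Real.log t| ≤ D) :
    C ^ pm * Real.exp (-(n * D / pm)) * t ^ (-(n:ℝ)) ≤ (C * t ^ (-(n:ℝ) / P)) ^ py := by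
  have hP0 : 0 < P := by linarith
  rw [Real.mul_rpow (by positivity) (by positivity), mul_assoc]
  refine mul_le_mul (Real.rpow_le_rpow_of_exponent_le hC hpy) ?_ (by positivity) (by positivity)
  rw [← Real.rpow_mul ht.le, Real.rpow_def_of_pos ht, Real.rpow_def_of_pos ht, ← Real.exp_add]
  refine Real.exp_le_exp.2 ?_
  have h1 : (py - P) * Real.log t ≤ D := (le_abs_self _).trans ((abs_mul _ _).trans_le hD)
  have hD0 : 0 ≤ D := le_trans (by positivity) hD
  have h2 : (n:ℝ) / P * ((py - P) * Real.log t) ≤ n * D / pm := by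
    calc (n:ℝ) / P * ((py - P) * Real.log t) ≤ n / P * D := by gcongr
      _ = n * D / P := by ring
      _ ≤ n * D / pm := by gcongr
  have h3 : Real.log t * (-(n:ℝ) / P * py) = Real.log t * (-n) - n / P * ((py - P) * Real.log t) := by
    field_simp; ring
  rw [h3]; linarith

lemma V1 {n : ℕ} {p : Rn n → ℝ} {pm : ℝ} (hpm : 0 < pm) (hp : ∀ x, pm ≤ p x)
    (hloc : LogHolderLocal p) : ∃ C ≥ 1, ∀ g : Rn n → ℝ≥0∞, ∫⁻ x, g x ^ p x ≤ 1 →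
    ∀ x t, 0 < t → t ≤ 1 → mm g x t ≤ ENNReal.ofReal (C * t ^ (-(n:ℝ) / p x)) := by
  obtain ⟨c, hc, hl⟩ := hloc
  have ho := om_pos n
  obtain ⟨C, hC1, hC⟩ := exC hpm (B := Real.exp (-(n * c / pm)) * ((1/4)^n * om n)) (by positivity)
  refine ⟨C, hC1, fun g hg x t ht ht1 => ?_⟩
  have hC0 : 0 < C := by linarith
  refine V0 (z := x) (r := t / 4) (K := C ^ pm * Real.exp (-(n * c / pm)) * t ^ (-(n:ℝ)))
    (fun x => hpm.trans_le (hp x)) hg (by positivity) (by positivity) (by positivity) ?_ ?_ ?_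
  · intro y hy
    rw [Metric.mem_ball] at hy
    linarith
  · intro y hy
    refine WW hpm hC1 ht (hp x) (hp y) ?_
    rw [Metric.mem_ball, dist_eq_norm] at hy
    by_cases hxy : y = x
    · simp [hxy, hc.le]
    have h0 : 0 < ‖y - x‖ := norm_pos_iff.2 (sub_ne_zero.2 hxy)
    have h1 := hl y x (by linarith)
    have h2 : Real.log ‖y - x‖ ≤ Real.log t := Real.log_le_log h0 (by linarith)
    have h3 : Real.log ‖y - x‖ < 0 := Real.log_neg h0 (by linarith)
    have h4 : Real.log t ≤ 0 := Real.log_nonpos ht.le ht1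
    rw [le_div_iff₀ (by linarith)] at h1
    rw [abs_of_nonpos h4]
    calc |p y - p x| * -Real.log t ≤ |p y - p x| * -Real.log ‖y - x‖ := by gcongr
      _ ≤ c := h1
  · calc 1 < _ := hC
      _ = C ^ pm * Real.exp (-(n * c / pm)) * (t ^ (-(n:ℝ)) * t ^ n) * ((1/4)^n * om n) := by
        rw [Real.rpow_neg ht.le, Real.rpow_natCast, inv_mul_cancel₀ (by positivity)]; ring
      _ = _ := by rw [div_eq_mul_one_div t 4, mul_pow]; ring

lemma pinf_mem {n : ℕ} (hn : 0 < n) {p : Rn n → ℝ} {C pinf : ℝ} (hC : 0 < C)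
    (h : ∀ x : Rn n, |p x - pinf| ≤ C / Real.log (Real.exp 1 + ‖x‖)) {ε : ℝ} (hε : 0 < ε) :
    ∃ x, |p x - pinf| ≤ ε := by
  refine ⟨EuclideanSpace.single ⟨0, hn⟩ (Real.exp (C / ε)), (h _).trans ?_⟩
  rw [PiLp.norm_single, Real.norm_of_nonneg (by positivity)]
  have h1 : C / ε ≤ Real.log (Real.exp 1 + Real.exp (C / ε)) := by
    rw [Real.le_log_iff_exp_le (by positivity)]
    linarith [Real.exp_pos 1]
  rw [div_le_iff₀ (lt_of_lt_of_le (by positivity) h1), ← div_le_iff₀' hε]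
  exact h1

lemma V2 {n : ℕ} (hn : 0 < n) {p : Rn n → ℝ} {pm Ci pinf : ℝ} (hpm : 0 < pm) (hp : ∀ x, pm ≤ p x)
    (hpi : pm ≤ pinf) (hCi : 0 < Ci)
    (hinf : ∀ x : Rn n, |p x - pinf| ≤ Ci / Real.log (Real.exp 1 + ‖x‖)) :
    ∃ C ≥ 1, ∀ g : Rn n → ℝ≥0∞, ∫⁻ x, g x ^ p x ≤ 1 →
    ∀ x t, 1 ≤ t → mm g x t ≤ ENNReal.ofReal (C * t ^ (-(n:ℝ) / pinf)) := by
  have ho := om_pos n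
  obtain ⟨C, hC1, hC⟩ := exC hpm (B := Real.exp (-(n * (2 * Ci) / pm)) * ((1/4)^n * om n))
    (by positivity)
  refine ⟨C, hC1, fun g hg x t ht1 => ?_⟩
  have hC0 : 0 < C := by linarith
  have ht : 0 < t := by linarith
  obtain ⟨z, hz1, hz2⟩ : ∃ z : Rn n, 3 * t / 4 ≤ ‖z‖ ∧ ‖z - x‖ ≤ 3 * t / 4 := by
    set e : Rn n := EuclideanSpace.single ⟨0, hn⟩ (3 * t / 4) with he
    have hne : ‖e‖ = 3 * t / 4 := by
      rw [he, PiLp.norm_single, Real.norm_of_nonneg (by positivity)]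
    by_cases h : 3 * t / 4 ≤ ‖x + e‖
    · exact ⟨x + e, h, by simp [hne]⟩
    · refine ⟨x - e, ?_, by simp [hne]⟩
      have h1 : ‖(x + e) - (x - e)‖ ≤ ‖x + e‖ + ‖x - e‖ := norm_sub_le _ _
      have h2 : (x + e) - (x - e) = (2:ℝ) • e := by rw [two_smul]; abel
      rw [h2, norm_smul, hne] at h1
      norm_num at h1
      linarith
  refine V0 (z := z) (r := t / 4) (K := C ^ pm * Real.exp (-(n * (2 * Ci) / pm)) * t ^ (-(n:ℝ)))
    (fun x => hpm.trans_le (hp x)) hg (by positivity) (by positivity) (by positivity) ?_ ?_ ?_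
  · intro y hy
    rw [Metric.mem_ball] at hy
    have := dist_triangle y z x
    rw [dist_eq_norm z x] at this
    linarith
  · intro y hy
    refine WW hpm hC1 ht hpi (hp y) ?_
    rw [Metric.mem_ball, dist_eq_norm] at hy
    have h0 : t / 2 ≤ ‖y‖ := by
      have := norm_sub_norm_le z y
      rw [norm_sub_rev] at this
      linarith
    have he : 2 ≤ Real.exp 1 := by linarith [Real.add_one_le_exp (1:ℝ)]
    have h1 : Real.log t ≤ 2 * Real.log (Real.exp 1 + ‖y‖) := by
      rw [← Real.log_rpow (by positivity)]
      refine Real.log_le_log ht ?_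
      rw [Real.rpow_two]
      nlinarith [norm_nonneg y]
    have h2 : 0 < Real.log (Real.exp 1 + ‖y‖) := Real.log_pos (by linarith [norm_nonneg y])
    have h3 := hinf y
    rw [le_div_iff₀ h2] at h3
    rw [abs_of_nonneg (Real.log_nonneg ht1)]
    calc |p y - pinf| * Real.log t ≤ |p y - pinf| * (2 * Real.log (Real.exp 1 + ‖y‖)) := by gcongr
      _ ≤ 2 * Ci := by linarith
  · calc 1 < _ := hC
      _ = C ^ pm * Real.exp (-(n * (2 * Ci) / pm)) * (t ^ (-(n:ℝ)) * t ^ n) * ((1/4)^n * om n) := by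
        rw [Real.rpow_neg ht.le, Real.rpow_natCast, inv_mul_cancel₀ (by positivity)]; ring
      _ = _ := by rw [div_eq_mul_one_div t 4, mul_pow]; ring

lemma L1 {α R : ℝ} (hα : 0 < α) (hR : 0 < R) :
    ∫⁻ t in Set.Ioc 0 R, ENNReal.ofReal (t ^ (α - 1)) = ENNReal.ofReal (R ^ α / α) := by
  have h0 : IntegrableOn (fun r : ℝ => r ^ (α - 1)) (Set.Ioc 0 R) :=
    (intervalIntegrable_iff_integrableOn_Ioc_of_le hR.le).1
      (intervalIntegral.intervalIntegrable_rpow' (by linarith))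
  rw [← ofReal_integral_eq_lintegral_ofReal h0, ← intervalIntegral.integral_of_le hR.le,
    integral_rpow (Or.inl (by linarith)), sub_add_cancel, Real.zero_rpow hα.ne', sub_zero]
  refine (ae_restrict_iff' measurableSet_Ioc).2 (Filter.Eventually.of_forall fun t ht => ?_)
  have := ht.1
  simp only [Pi.zero_apply]
  positivity

lemma L2 {α R C s : ℝ} (hC : 0 < C) (hs : α < s) (hR : 0 < R) :
    ∫⁻ t in Set.Ioi R, ENNReal.ofReal (t ^ (α - 1)) * ENNReal.ofReal (C * t ^ (-s)) =
      ENNReal.ofReal (C * (R ^ (α - s) / (s - α))) := by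
  have e : ∀ t ∈ Set.Ioi R, ENNReal.ofReal (t ^ (α - 1)) * ENNReal.ofReal (C * t ^ (-s)) =
      ENNReal.ofReal C * ENNReal.ofReal (t ^ (α - s - 1)) := by
    intro t ht
    have ht : 0 < t := hR.trans ht
    rw [← ENNReal.ofReal_mul (by positivity), ← ENNReal.ofReal_mul (by positivity), mul_left_comm,
      ← Real.rpow_add ht]
    congr 3; ring
  rw [setLIntegral_congr_fun measurableSet_Ioi e, lintegral_const_mul' _ _ ENNReal.ofReal_ne_top,
    ENNReal.ofReal_mul hC.le, ← ofReal_integral_eq_lintegral_ofReal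
      (integrableOn_Ioi_rpow_of_lt (by linarith) hR), integral_Ioi_rpow_of_lt (by linarith) hR]
  · congr 2
    rw [sub_add_cancel, neg_div, ← div_neg, neg_sub]
  refine (ae_restrict_iff' measurableSet_Ioi).2 (Filter.Eventually.of_forall fun t ht => ?_)
  have : 0 < t := hR.trans ht
  simp only [Pi.zero_apply]
  positivity


lemma piece0 {n : ℕ} {α R G : ℝ} (hα : 0 < α) (hR : 0 < R) (hG : 0 ≤ G) {g : Rn n → ℝ≥0∞} {x : Rn n}
    (hg : g x = ENNReal.ofReal G) :
    ∫⁻ t in Set.Ioc 0 R, ENNReal.ofReal (t ^ (α - 1)) * mm g x t ≤ ENNReal.ofReal (R ^ α / α * G) := by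
  rw [ENNReal.ofReal_mul (by positivity), ← L1 hα hR,
    ← lintegral_mul_const' _ _ ENNReal.ofReal_ne_top]
  refine setLIntegral_mono' measurableSet_Ioc fun t ht => ?_
  gcongr
  rw [← hg]
  exact mm_le g x x t (by simpa using ht.1.le)

lemma piece1 {n : ℕ} {α R C s δ : ℝ} (hC : 0 < C) (hδ : 0 < δ) (hs : δ ≤ s - α) (hR : 0 < R)
    {S : Set ℝ} (hS : MeasurableSet S) (hSR : S ⊆ Set.Ioi R)
    {g : Rn n → ℝ≥0∞} {x : Rn n} (H : ∀ t ∈ S, mm g x t ≤ ENNReal.ofReal (C * t ^ (-s))) :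
    ∫⁻ t in S, ENNReal.ofReal (t ^ (α - 1)) * mm g x t ≤
      ENNReal.ofReal (C / δ * R ^ (α - s)) := by
  calc ∫⁻ t in S, ENNReal.ofReal (t ^ (α - 1)) * mm g x t
      ≤ ∫⁻ t in S, ENNReal.ofReal (t ^ (α - 1)) * ENNReal.ofReal (C * t ^ (-s)) := by
        refine setLIntegral_mono' hS fun t ht => ?_
        gcongr
        exact H t ht
    _ ≤ ∫⁻ t in Set.Ioi R, ENNReal.ofReal (t ^ (α - 1)) * ENNReal.ofReal (C * t ^ (-s)) :=
        lintegral_mono_set hSR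
    _ = ENNReal.ofReal (C * (R ^ (α - s) / (s - α))) := L2 hC (by linarith) hR
    _ ≤ _ := by
      refine ENNReal.ofReal_le_ofReal ?_
      rw [div_mul_eq_mul_div, ← mul_div_assoc]
      gcongr

lemma pow_id1 {n α P G : ℝ} (hn : 0 < n) (hG : 0 < G) :
    (G ^ (-P / n)) ^ α * G = G ^ (1 - α * P / n) := by
  rw [← Real.rpow_mul hG.le]
  nth_rewrite 2 [← Real.rpow_one G]
  rw [← Real.rpow_add hG]
  congr 1; field_simp; ring

lemma pow_id2 {n α P G : ℝ} (hn : 0 < n) (hP : 0 < P) (hG : 0 < G) :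
    (G ^ (-P / n)) ^ (α - n / P) = G ^ (1 - α * P / n) := by
  rw [← Real.rpow_mul hG.le]
  congr 1; field_simp; ring

lemma J_big {n : ℕ} (hn : 0 < n) {α δ C1 C2 P Q G : ℝ} (hα : 0 < α) (hδ : 0 < δ) (hC1 : 0 < C1)
    (hC2 : 0 < C2) (hP : 0 < P) (hPδ : δ ≤ n / P - α) (hQδ : δ ≤ n / Q - α)
    (hexp : 0 ≤ 1 - α * P / n) (hG : 1 ≤ G) {g : Rn n → ℝ≥0∞} {x : Rn n}
    (hg : g x = ENNReal.ofReal G)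
    (H1 : ∀ t, 0 < t → t ≤ 1 → mm g x t ≤ ENNReal.ofReal (C1 * t ^ (-(n:ℝ) / P)))
    (H2 : ∀ t, 1 ≤ t → mm g x t ≤ ENNReal.ofReal (C2 * t ^ (-(n:ℝ) / Q))) :
    JJ α g x ≤ ENNReal.ofReal ((1 / α + C1 / δ + C2 / δ) * G ^ (1 - α * P / n)) := by
  have hn' : (0:ℝ) < n := by exact_mod_cast hn
  have hG0 : 0 < G := by linarith
  set R := G ^ (-P / n) with hRd
  have hR : 0 < R := by positivity
  have hR1 : R ≤ 1 := Real.rpow_le_one_of_one_le_of_nonpos hG (by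
    rw [neg_div]; have : 0 < P / n := by positivity
    linarith)
  have hI : 1 ≤ G ^ (1 - α * P / n) := Real.one_le_rpow hG hexp
  change ∫⁻ t in Set.Ioi (0:ℝ), ENNReal.ofReal (t ^ (α - 1)) * mm g x t ≤ _
  have hset : Set.Ioi (0:ℝ) = Set.Ioc 0 R ∪ (Set.Ioc R 1 ∪ Set.Ioi 1) := by
    rw [Set.Ioc_union_Ioi_eq_Ioi hR1, Set.Ioc_union_Ioi_eq_Ioi hR.le]
  rw [hset]
  refine (lintegral_union_le _ _ _).trans ?_
  refine (add_le_add (piece0 hα hR hG0.le hg) ((lintegral_union_le _ _ _).trans (add_le_add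
    (piece1 (R := R) (s := n / P) hC1 hδ hPδ hR measurableSet_Ioc (fun t ht => ht.1) ?_)
    (piece1 (R := 1) (s := n / Q) hC2 hδ hQδ one_pos measurableSet_Ioi subset_rfl ?_)))).trans ?_
  · intro t ht
    rw [← neg_div]
    exact H1 t (hR.trans ht.1) ht.2
  · intro t ht
    rw [← neg_div]
    exact H2 t (le_of_lt ht)
  · rw [← ENNReal.ofReal_add (by positivity) (by positivity),
      ← ENNReal.ofReal_add (by positivity) (by positivity)]
    refine ENNReal.ofReal_le_ofReal ?_
    rw [hRd, pow_id2 hn' hP hG0, div_mul_eq_mul_div, pow_id1 hn' hG0, Real.one_rpow]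
    have : C2 / δ * 1 ≤ C2 / δ * G ^ (1 - α * P / n) := by gcongr
    linarith [div_eq_mul_one_div (G ^ (1 - α * P / n)) α]

lemma J_small {n : ℕ} (hn : 0 < n) {α δ C2 Q G : ℝ} (hα : 0 < α) (hδ : 0 < δ)
    (hC2 : 0 < C2) (hQ : 0 < Q) (hQδ : δ ≤ n / Q - α)
    (hG0 : 0 < G) (hG : G ≤ 1) {g : Rn n → ℝ≥0∞} {x : Rn n}
    (hg : g x = ENNReal.ofReal G)
    (H2 : ∀ t, 1 ≤ t → mm g x t ≤ ENNReal.ofReal (C2 * t ^ (-(n:ℝ) / Q))) :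
    JJ α g x ≤ ENNReal.ofReal ((1 / α + C2 / δ) * G ^ (1 - α * Q / n)) := by
  have hn' : (0:ℝ) < n := by exact_mod_cast hn
  set R := G ^ (-Q / n) with hRd
  have hR : 0 < R := by positivity
  have hR1 : 1 ≤ R := Real.one_le_rpow_of_pos_of_le_one_of_nonpos hG0 hG (by
    rw [neg_div]; have : 0 < Q / n := by positivity
    linarith)
  change ∫⁻ t in Set.Ioi (0:ℝ), ENNReal.ofReal (t ^ (α - 1)) * mm g x t ≤ _
  rw [← Set.Ioc_union_Ioi_eq_Ioi hR.le]
  refine (lintegral_union_le _ _ _).trans ?_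
  refine (add_le_add (piece0 hα hR hG0.le hg) 
    (piece1 (R := R) (s := n / Q) hC2 hδ hQδ hR measurableSet_Ioi subset_rfl ?_)).trans ?_
  · intro t ht
    rw [← neg_div]
    exact H2 t (hR1.trans (le_of_lt ht))
  · rw [← ENNReal.ofReal_add (by positivity) (by positivity)]
    refine ENNReal.ofReal_le_ofReal ?_
    rw [hRd, pow_id2 hn' hQ hG0, div_mul_eq_mul_div, pow_id1 hn' hG0]
    linarith [div_eq_mul_one_div (G ^ (1 - α * Q / n)) α]

/-- the pointwise exponent comparison -/
lemma G_exp {G a E P K D m : ℝ} (hG0 : 0 < G) (hG1 : G ≤ 1) (ha : 1 < a) (hK : 0 ≤ K)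
    (hEP : |E - P| * Real.log a ≤ D) (hm : m ≤ K * E) (hE : 0 ≤ E) :
    G ^ E ≤ Real.exp (D * K) * G ^ P + a ^ (-m) := by
  have ha0 : 0 < a := by linarith
  have hla : 0 < Real.log a := Real.log_pos ha
  by_cases h : a ^ (-K) ≤ G
  · have h1 : -K * Real.log a ≤ Real.log G := by
      rw [← Real.log_rpow ha0]; exact Real.log_le_log (by positivity) h
    have h2 : Real.log G ≤ 0 := Real.log_nonpos hG0.le hG1
    have h3 : G ^ E ≤ Real.exp (D * K) * G ^ P := by
      rw [Real.rpow_def_of_pos hG0, Real.rpow_def_of_pos hG0, ← Real.exp_add]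
      refine Real.exp_le_exp.2 ?_
      have h4 : Real.log G * (E - P) ≤ D * K := by
        calc Real.log G * (E - P) ≤ |Real.log G * (E - P)| := le_abs_self _
          _ = -Real.log G * |E - P| := by rw [abs_mul, abs_of_nonpos h2]
          _ ≤ (K * Real.log a) * |E - P| := by gcongr; linarith
          _ = (|E - P| * Real.log a) * K := by ring
          _ ≤ D * K := by gcongr
      linarith
    have : 0 < a ^ (-m) := by positivity
    linarith
  · have h1 : G ^ E ≤ a ^ (-m) := by
      calc G ^ E ≤ (a ^ (-K)) ^ E := Real.rpow_le_rpow hG0.le (not_le.mp h).le hE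
        _ = a ^ (-(K * E)) := by rw [← Real.rpow_mul ha0.le]; congr 1; ring
        _ ≤ a ^ (-m) := Real.rpow_le_rpow_of_exponent_le ha.le (by linarith)
    have : 0 < Real.exp (D * K) * G ^ P := by positivity
    linarith

lemma JJ_mono_zero {n : ℕ} {α : ℝ} {g : Rn n → ℝ≥0∞} {x : Rn n} (hg : g x = 0) : JJ α g x = 0 := by
  change ∫⁻ t in Set.Ioi (0:ℝ), ENNReal.ofReal (t ^ (α - 1)) * mm g x t = 0
  rw [setLIntegral_congr_fun (g := fun _ => 0) measurableSet_Ioi, lintegral_zero]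
  intro t ht
  have := mm_le g x x t (by simpa using le_of_lt ht)
  rw [hg, nonpos_iff_eq_zero] at this
  simp [this]

lemma main_var {n : ℕ} (hn : 0 < n)
    {α : ℝ} (hα : 0 < α) (p q : Rn n → ℝ)
    (hploc : LogHolderLocal p) (hpinf : LogHolderInfty p)
    {pm pp : ℝ} (hpm : 0 < pm) (hpmle : ∀ x, pm ≤ p x) (hple : ∀ x, p x ≤ pp)
    (hpp : pp * α < n)
    (hq : ∀ x, 1 / q x = 1 / p x - α / n) :
    (∀ x, pm ≤ q x) ∧ ∃ A : ℝ, 1 ≤ A ∧ ∀ g : Rn n → ℝ≥0∞, ∫⁻ x, g x ^ p x ≤ 1 →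
      ∫⁻ x, JJ α g x ^ q x ≤ ENNReal.ofReal A := by
  have hn' : (0:ℝ) < n := by exact_mod_cast hn
  obtain ⟨C1, hC1, H1⟩ := V1 hpm hpmle hploc
  obtain ⟨Ci, hCi, Q, hinf⟩ := hpinf
  have hQm : pm ≤ Q := by
    refine le_of_forall_pos_le_add fun ε hε => ?_
    obtain ⟨x, hx⟩ := pinf_mem hn hCi hinf hε
    have := (abs_le.1 hx).2
    linarith [hpmle x]
  have hQp : Q ≤ pp := by
    refine le_of_forall_pos_le_add fun ε hε => ?_
    obtain ⟨x, hx⟩ := pinf_mem hn hCi hinf hε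
    have := (abs_le.1 hx).1
    linarith [hple x]
  have hQ0 : 0 < Q := by linarith
  have hpp0 : 0 < pp := by linarith
  obtain ⟨C2, hC2, H2⟩ := V2 hn hpm hpmle hQm hCi hinf
  set δ := n / pp - α with hδd
  have hδ : 0 < δ := by rw [hδd, sub_pos, lt_div_iff₀ hpp0]; linarith
  have hp0 : ∀ x, 0 < p x := fun x => hpm.trans_le (hpmle x)
  have hPδ : ∀ P, 0 < P → P ≤ pp → δ ≤ n / P - α := by
    intro P h1 h2
    have : n / pp ≤ n / P := by gcongr
    linarith
  set κ0 := 1 - α * pp / n with hκ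
  have hκ0 : 0 < κ0 := by rw [hκ, sub_pos, div_lt_one hn']; linarith
  have hκP : ∀ P, P ≤ pp → κ0 ≤ 1 - α * P / n := by
    intro P h
    have : α * P / n ≤ α * pp / n := by gcongr
    linarith
  have hqinv : ∀ x, 0 < 1 / q x := by
    intro x
    rw [hq x, sub_pos, div_lt_div_iff₀ hn' (hp0 x)]
    nlinarith [hple x]
  have hq0 : ∀ x, 0 < q x := fun x => one_div_pos.1 (hqinv x)
  have hpq : ∀ x, p x = (1 - α * p x / n) * q x := by
    intro x
    have h1 := hq x
    have := hp0 x; have := hq0 x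
    field_simp at h1 ⊢
    linarith
  have hqp : ∀ x, p x ≤ q x := by
    intro x
    have h1 := hpq x
    have h2 : 0 ≤ α * p x / n * q x := by
      have := hp0 x; have := hq0 x; positivity
    nlinarith
  set qM := pp / κ0 with hqM
  have hqM0 : 0 < qM := by positivity
  have hqle : ∀ x, q x ≤ qM := by
    intro x
    rw [hqM, le_div_iff₀ hκ0]
    have h1 := hpq x
    have h2 := hκP _ (hple x)
    have := hq0 x
    nlinarith [hple x]
  refine ⟨fun x => (hpmle x).trans (hqp x), ?_⟩
  set C3 := 1 + (1 / α + C1 / δ + C2 / δ) with hC3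
  have hC1' : 0 < C1 := by linarith
  have hC2' : 0 < C2 := by linarith
  have hC31 : 1 ≤ C3 := by
    have : 0 < 1 / α + C1 / δ + C2 / δ := by positivity
    linarith
  set K := ((n:ℝ) + 1) / (κ0 * pm) with hK
  have hK0 : 0 < K := by positivity
  set D := qM * (α / n) * Ci with hD
  have hD0 : 0 < D := by positivity
  set A1 := C3 ^ qM * Real.exp (D * K) with hA1
  have hC30 : 0 < C3 := by linarith
  have hA10 : 0 < A1 := by positivity
  have hE1 : 1 ≤ Real.exp (D * K) := Real.one_le_exp (by positivity)
  have hC3q : ∀ x, C3 ^ q x ≤ C3 ^ qM := fun x => Real.rpow_le_rpow_of_exponent_le hC31 (hqle x)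
  have hw0 := wI_nonneg n (n+1)
  have hC3M : 1 ≤ C3 ^ qM := Real.one_le_rpow hC31 hqM0.le
  refine ⟨A1 * (1 + wI n (n + 1)), ?_, fun g hg => ?_⟩
  · have : 1 ≤ A1 := by
      have := one_le_mul_of_one_le_of_one_le hC3M hE1
      simpa [hA1] using this
    nlinarith
  have key : ∀ x, JJ α g x ^ q x ≤ ENNReal.ofReal A1 *
      (g x ^ p x + ENNReal.ofReal ((1 + ‖x‖) ^ (n + 1))⁻¹) := by
    intro x
    by_cases hgt : g x = ⊤
    · rw [hgt, ENNReal.top_rpow_of_pos (hp0 x), top_add, ENNReal.mul_top (by simpa using hA10)]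
      exact le_top
    by_cases hg0 : g x = 0
    · rw [JJ_mono_zero hg0, ENNReal.zero_rpow_of_pos (hq0 x)]; exact zero_le
    set G := (g x).toReal with hGd
    have hG0 : 0 < G := ENNReal.toReal_pos hg0 hgt
    have hgx : g x = ENNReal.ofReal G := (ENNReal.ofReal_toReal hgt).symm
    have hfin : ∀ κ, JJ α g x ≤ ENNReal.ofReal (C3 * G ^ κ) →
        (G ^ (κ * q x) ≤ Real.exp (D * K) * (G ^ p x + ((1 + ‖x‖) ^ (n + 1))⁻¹)) →
        JJ α g x ^ q x ≤ ENNReal.ofReal A1 *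
          (g x ^ p x + ENNReal.ofReal ((1 + ‖x‖) ^ (n + 1))⁻¹) := by
      intro κ h1 h2
      calc JJ α g x ^ q x ≤ ENNReal.ofReal (C3 * G ^ κ) ^ q x := ENNReal.rpow_le_rpow h1 (hq0 x).le
        _ = ENNReal.ofReal (C3 ^ q x * G ^ (κ * q x)) := by
          rw [ENNReal.ofReal_rpow_of_pos (by positivity), Real.mul_rpow (by positivity) (by positivity),
            ← Real.rpow_mul hG0.le]
        _ ≤ ENNReal.ofReal (A1 * (G ^ p x + ((1 + ‖x‖) ^ (n + 1))⁻¹)) := by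
          refine ENNReal.ofReal_le_ofReal ?_
          rw [hA1, mul_assoc]
          exact mul_le_mul (hC3q x) h2 (by positivity) (by positivity)
        _ = _ := by
          rw [ENNReal.ofReal_mul hA10.le, ENNReal.ofReal_add (by positivity) (by positivity), hgx,
            ENNReal.ofReal_rpow_of_pos hG0]
    rcases le_total 1 G with hG | hG
    · refine hfin (1 - α * p x / n) ?_ ?_
      · refine (J_big hn hα hδ hC1' hC2' (hp0 x) (hPδ _ (hp0 x) (hple x)) (hPδ _ hQ0 hQp)
          (hκ0.le.trans (hκP _ (hple x))) hG hgx (H1 g hg x) (H2 g hg x)).trans ?_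
        refine ENNReal.ofReal_le_ofReal ?_
        gcongr
        linarith
      · rw [← hpq x]
        have : 0 < ((1 + ‖x‖) ^ (n + 1))⁻¹ := by positivity
        have h3 : 0 < G ^ p x := by positivity
        nlinarith
    · refine hfin (1 - α * Q / n) ?_ ?_
      · refine (J_small hn hα hδ hC2' hQ0 (hPδ _ hQ0 hQp) hG0 hG hgx (H2 g hg x)).trans ?_
        refine ENNReal.ofReal_le_ofReal ?_
        gcongr
        have : 0 < C1 / δ := by positivity
        linarith
      · have he : 2 ≤ Real.exp 1 := by linarith [Real.add_one_le_exp (1:ℝ)]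
        have ha : 1 < Real.exp 1 + ‖x‖ := by linarith [norm_nonneg x]
        have hla := Real.log_pos ha
        have hκQ := hκP _ hQp
        have h1 := G_exp (G := G) (a := Real.exp 1 + ‖x‖) (E := (1 - α * Q / n) * q x) (P := p x)
          (K := K) (D := D) (m := n + 1) hG0 hG ha hK0.le ?_ ?_ ?_
        · have h2 : (Real.exp 1 + ‖x‖) ^ (-((n:ℝ) + 1)) ≤ ((1 + ‖x‖) ^ (n + 1))⁻¹ := by
            rw [Real.rpow_neg (by positivity)]
            have : (Real.exp 1 + ‖x‖) ^ ((n:ℝ) + 1) = (Real.exp 1 + ‖x‖) ^ (n + 1) := by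
              rw [← Real.rpow_natCast]; push_cast; rfl
            rw [this]
            gcongr
            linarith
          have h3 : 0 < ((1 + ‖x‖) ^ (n + 1))⁻¹ := by positivity
          nlinarith
        · have h4 : (1 - α * Q / n) * q x - p x = q x * (α / n) * (p x - Q) := by
            have := hpq x
            nth_rewrite 1 [this]
            field_simp; ring
          have h5 := hinf x
          rw [le_div_iff₀ hla] at h5
          rw [h4, abs_mul, abs_of_pos (by have := hq0 x; positivity), hD, mul_assoc]
          refine mul_le_mul ?_ h5 (by positivity) (by positivity)
          gcongr
          exact hqle x
        · have h6 : κ0 * pm ≤ (1 - α * Q / n) * q x := by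
            have := (hpmle x).trans (hqp x)
            exact mul_le_mul hκQ this hpm.le (by linarith)
          rw [hK]
          calc (n:ℝ) + 1 = (n + 1) / (κ0 * pm) * (κ0 * pm) := by field_simp
            _ ≤ _ := by gcongr
        · have := hq0 x
          exact mul_nonneg (by linarith) this.le
  refine (lintegral_mono key).trans ?_
  rw [lintegral_const_mul' _ _ ENNReal.ofReal_ne_top, lintegral_add_right _ (by fun_prop),
    ← ofReal_integral_eq_lintegral_ofReal (integrable_w le_rfl)
      (Filter.Eventually.of_forall fun y => by positivity), ← wI, ENNReal.ofReal_mul hA10.le,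
    ENNReal.ofReal_add zero_le_one hw0, ENNReal.ofReal_one]
  gcongr


lemma JJ_smul {n : ℕ} (α : ℝ) (g : Rn n → ℝ≥0∞) (x : Rn n) {c : ℝ≥0∞} (h0 : c ≠ 0) (ht : c ≠ ⊤) :
    JJ α (fun w => c * g w) x = c * JJ α g x := by
  unfold JJ
  rw [← lintegral_const_mul' _ _ ht]
  congr 1; ext t
  rw [mul_left_comm, ENNReal.mul_iInf_of_ne h0 ht]

theorem riesz_potential_Hp_to_Hq
    {n : ℕ} (hn : 0 < n)
    (α : ℝ) (hα0 : 0 < α) (hαn : α < n)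
    (p q : Rn n → ℝ)
    (hploc : LogHolderLocal p) (hpinf : LogHolderInfty p)
    (pm pp : ℝ) (hpm : 0 < pm) (hpmle : ∀ x, pm ≤ p x) (hple : ∀ x, p x ≤ pp)
    (hpp : pp * α < n)
    (hq : ∀ x, 1 / q x = 1 / p x - α / n) :
    ∃ N₀ : ℕ, ∀ N ≥ N₀, ∃ C > 0, ∀ f : Rn n → ℝ, Measurable f →
      hardyNorm q N (riesz α f) ≤ ENNReal.ofReal C * hardyNorm p N f := by
  refine ⟨n + 1, fun N hN => ?_⟩
  obtain ⟨C4, hC4, H4⟩ := grandMax_riesz hn hN hα0 hαn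
  obtain ⟨hqm, A, hA1, HA⟩ := main_var hn hα0 p q hploc hpinf hpm hpmle hple hpp hq
  have hA0 : 0 < A := by linarith
  set B := A ^ (1 / pm) with hB
  have hB1 : 1 ≤ B := Real.one_le_rpow hA1 (by positivity)
  have hB0 : 0 < B := by linarith
  have hBA : B ^ pm = A := by
    rw [hB, ← Real.rpow_mul hA0.le, one_div_mul_cancel hpm.ne', Real.rpow_one]
  refine ⟨C4 * B, by positivity, fun f hf => ?_⟩
  unfold hardyNorm varLpNormE
  have hc0 : ENNReal.ofReal (C4 * B) ≠ 0 := by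
    have : 0 < C4 * B := by positivity
    simpa using this
  rw [mul_comm, ← ENNReal.div_le_iff hc0 ENNReal.ofReal_ne_top]
  refine le_sInf ?_
  rintro l ⟨lam, hlam, rfl, hint⟩
  rw [ENNReal.div_le_iff hc0 ENNReal.ofReal_ne_top, ← ENNReal.ofReal_mul hlam.le]
  refine sInf_le ⟨lam * (C4 * B), by positivity, rfl, ?_⟩
  have hl0 : ENNReal.ofReal lam ≠ 0 := by simpa using hlam
  set g : Rn n → ℝ≥0∞ := fun x => grandMax n N f x / ENNReal.ofReal lam with hg
  have hgf : grandMax n N f = fun w => ENNReal.ofReal lam * g w := by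
    ext w
    rw [hg, ENNReal.mul_div_cancel hl0 ENNReal.ofReal_ne_top]
  have hpt : ∀ x, (grandMax n N (riesz α f) x / ENNReal.ofReal (lam * (C4 * B))) ^ q x ≤
      ENNReal.ofReal A⁻¹ * JJ α g x ^ q x := by
    intro x
    have hq0 : 0 < q x := hpm.trans_le (hqm x)
    have h1 := H4 f hf x
    rw [hgf, JJ_smul α g x hl0 ENNReal.ofReal_ne_top] at h1
    have h2 : grandMax n N (riesz α f) x / ENNReal.ofReal (lam * (C4 * B)) ≤
        ENNReal.ofReal B⁻¹ * JJ α g x := by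
      refine ENNReal.div_le_of_le_mul (h1.trans (le_of_eq ?_))
      rw [← mul_assoc, ← ENNReal.ofReal_mul hC4.le, mul_right_comm, ← ENNReal.ofReal_mul (by positivity)]
      congr 2
      field_simp
    calc _ ≤ (ENNReal.ofReal B⁻¹ * JJ α g x) ^ q x := ENNReal.rpow_le_rpow h2 hq0.le
      _ = ENNReal.ofReal (B⁻¹ ^ q x) * JJ α g x ^ q x := by
        rw [ENNReal.mul_rpow_of_nonneg _ _ hq0.le, ENNReal.ofReal_rpow_of_pos (by positivity)]
      _ ≤ _ := by
        gcongr
        rw [← hBA, ← Real.inv_rpow hB0.le]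
        exact Real.rpow_le_rpow_of_exponent_ge (by positivity) (inv_le_one_of_one_le₀ hB1) (hqm x)
  calc _ ≤ ∫⁻ x, ENNReal.ofReal A⁻¹ * JJ α g x ^ q x := lintegral_mono hpt
    _ = ENNReal.ofReal A⁻¹ * ∫⁻ x, JJ α g x ^ q x := lintegral_const_mul' _ _ ENNReal.ofReal_ne_top
    _ ≤ ENNReal.ofReal A⁻¹ * ENNReal.ofReal A := by
      gcongr
      exact HA g hint
    _ = 1 := by
      rw [← ENNReal.ofReal_mul (by positivity), inv_mul_cancel₀ hA0.ne', ENNReal.ofReal_one]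
end

section
/- Suppose p : ℝⁿ → (0,∞) satisfies the local log-Hölder condition and the log-Hölder condition at infinity with constants p_∞, C_∞, and 0 < p₋ ≤ p₊ < ∞. Then for all cubes Q = Q(z,r) with z ∈ ℝⁿ and side length r ≤ 1, one has |Q|^{1/p₋(Q)} ≲ |Q|^{1/p₊(Q)}, and in particular |Q|^{1/p₋(Q)} ∼ |Q|^{1/p₊(Q)} ∼ |Q|^{1/p(z)} ∼ ‖χ_Q‖_{p(·)}, where the implicit constants do not depend on z and r. -/
open MeasureTheory ENNReal

lemma cube_eq_preimage {n : ℕ} (z : Rn n) (r : ℝ) :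
    cube z r = (WithLp.ofLp : Rn n → (Fin n → ℝ)) ⁻¹'
      (Set.pi Set.univ fun i => Set.Icc (z i - r / 2) (z i + r / 2)) := by
  ext x
  simp only [cube, Set.mem_setOf_eq, Set.mem_preimage, Set.mem_pi, Set.mem_univ, true_imp_iff,
    Set.mem_Icc, abs_le]
  refine forall_congr' fun i => ⟨fun h => ⟨by linarith [h.1], by linarith [h.2]⟩,
    fun h => ⟨by linarith [h.1], by linarith [h.2]⟩⟩

lemma cube_box_meas {n : ℕ} (z : Rn n) (r : ℝ) :
    MeasurableSet (Set.pi Set.univ fun i => Set.Icc (z i - r / 2) (z i + r / 2)) :=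
  MeasurableSet.univ_pi fun _ => measurableSet_Icc

lemma cube_meas {n : ℕ} (z : Rn n) (r : ℝ) : MeasurableSet (cube z r) := by
  rw [cube_eq_preimage]
  exact (PiLp.volume_preserving_ofLp (Fin n)).measurable (cube_box_meas z r)

lemma cube_vol {n : ℕ} (z : Rn n) (r : ℝ) :
    volume (cube z r) = ENNReal.ofReal r ^ n := by
  rw [cube_eq_preimage, (PiLp.volume_preserving_ofLp (Fin n)).measure_preimage
    (cube_box_meas z r).nullMeasurableSet, volume_pi_pi]
  have : ∀ i, z i + r / 2 - (z i - r / 2) = r := fun i => by ring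
  simp [Real.volume_Icc, this]

lemma cube_norm_le {n : ℕ} {z x y : Rn n} {r : ℝ} (hx : x ∈ cube z r)
    (hy : y ∈ cube z r) (hr : 0 < r) (hn : 0 < n) : ‖x - y‖ ≤ n * r := by
  have h1 : ∀ i, ‖(x - y) i‖ ≤ r := fun i => by
    have a := abs_le.1 (hx i)
    have b := abs_le.1 (hy i)
    rw [PiLp.sub_apply, Real.norm_eq_abs, abs_le]
    constructor <;> linarith [a.1, a.2, b.1, b.2]
  rw [EuclideanSpace.norm_eq]
  apply Real.sqrt_le_iff.2
  refine ⟨by positivity, ?_⟩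
  have hn1 : (1 : ℝ) ≤ n := by exact_mod_cast hn
  calc ∑ i, ‖(x - y) i‖ ^ 2 ≤ ∑ _i : Fin n, r ^ 2 :=
        Finset.sum_le_sum fun i _ => by have := h1 i; gcongr
    _ = n * r ^ 2 := by simp
    _ ≤ (n * r) ^ 2 := by nlinarith [mul_nonneg (sub_nonneg.2 hn1) (by positivity : 0 ≤ (n:ℝ) * r ^ 2)]

lemma osc_bound {n : ℕ} (hn : 0 < n) (p : Rn n → ℝ) (c : ℝ) (hc : 0 < c)
    (hloc : ∀ x y : Rn n, ‖x - y‖ < 1/2 → |p x - p y| ≤ c / (-Real.log ‖x - y‖))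
    (pm pp : ℝ) (hpmle : ∀ x, pm ≤ p x) (hple : ∀ x, p x ≤ pp)
    (z x y : Rn n) (r : ℝ) (hr : 0 < r) (hr1 : r ≤ 1) (hx : x ∈ cube z r) (hy : y ∈ cube z r) :
    (p x - p y) * (n * (-Real.log r)) ≤ 2 * c * n + n * Real.log (4 * n ^ 2) * (pp - pm) := by
  have hn1 : (1 : ℝ) ≤ n := by exact_mod_cast hn
  have hlr : 0 ≤ -Real.log r := by linarith [Real.log_nonpos hr.le hr1]
  have hl4 : 0 ≤ Real.log (4 * (n:ℝ) ^ 2) := Real.log_nonneg (by nlinarith)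
  have hpp : 0 ≤ pp - pm := by linarith [hpmle x, hple x]
  have hd : p x - p y ≤ pp - pm := by linarith [hpmle y, hple x]
  have hA : 0 ≤ n * Real.log (4 * (n:ℝ) ^ 2) * (pp - pm) := by positivity
  have hB : 0 ≤ 2 * c * n := by positivity
  rcases eq_or_ne x y with rfl | hxy
  · simp only [sub_self, zero_mul]; linarith
  rcases lt_or_ge (r * (4 * (n:ℝ) ^ 2)) 1 with h | h
  · have hnorm := cube_norm_le hx hy hr hn
    have hpos : 0 < ‖x - y‖ := norm_pos_iff.2 (sub_ne_zero.2 hxy)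
    have hnr : n * r < 1 / 2 := by nlinarith
    have h1 := hloc x y (by linarith)
    have hrlt : r < 1 := by nlinarith
    have hlr' : 0 < -Real.log r := by linarith [Real.log_neg hr hrlt]
    have h2 : Real.log ‖x - y‖ ≤ Real.log n + Real.log r := by
      rw [← Real.log_mul (by positivity) hr.ne']
      exact Real.log_le_log hpos hnorm
    have h3 : 2 * Real.log n + Real.log r ≤ 0 := by
      have : 2 * Real.log n + Real.log r = Real.log ((n:ℝ) ^ 2 * r) := by
        rw [Real.log_mul (by positivity) hr.ne', Real.log_pow]; norm_num
      rw [this]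
      exact Real.log_nonpos (by positivity) (by nlinarith [mul_pos hr (by positivity : 0 < (n:ℝ)^2)])
    have h4 : -Real.log r / 2 ≤ -Real.log ‖x - y‖ := by linarith
    have h5 : p x - p y ≤ c / (-Real.log r / 2) :=
      (le_abs_self _).trans (h1.trans (div_le_div_of_nonneg_left hc.le (by linarith) h4))
    have h6 : (p x - p y) * (n * (-Real.log r)) ≤ c / (-Real.log r / 2) * (n * (-Real.log r)) := by
      gcongr
    have h7 : c / (-Real.log r / 2) * (n * (-Real.log r)) = 2 * c * n := by
      field_simp
      exact div_self (ne_of_lt (by linarith))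
    linarith
  · have h1 : -Real.log r ≤ Real.log (4 * (n:ℝ) ^ 2) := by
      have := Real.log_nonneg h
      rw [Real.log_mul hr.ne' (by positivity)] at this
      linarith
    calc (p x - p y) * (n * (-Real.log r)) ≤ (pp - pm) * (n * Real.log (4 * (n:ℝ) ^ 2)) := by
          gcongr
      _ ≤ _ := by linarith

lemma exp_cmp {pm K L a b : ℝ} (hpm : 0 < pm) (hK : 0 ≤ K) (ha : pm ≤ a) (hb : pm ≤ b)
    (h : (a - b) * L ≤ K) :
    Real.exp (-L) ^ (1 / a) ≤ Real.exp (K / pm ^ 2) * Real.exp (-L) ^ (1 / b) := by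
  rw [← Real.exp_mul, ← Real.exp_mul, ← Real.exp_add]
  apply Real.exp_le_exp.2
  have ha0 : 0 < a := hpm.trans_le ha
  have hb0 : 0 < b := hpm.trans_le hb
  have h1 : -L * (1 / a) - -L * (1 / b) = (a - b) * L / (a * b) := by
    field_simp; ring
  have h2 : (a - b) * L / (a * b) ≤ K / (a * b) := by gcongr
  have h3 : K / (a * b) ≤ K / pm ^ 2 := by
    rw [pow_two]; gcongr
  linarith

lemma ind_pow {n : ℕ} (p : Rn n → ℝ) (hp : ∀ x, 0 < p x) (z : Rn n) (r lam : ℝ)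
    (hl : 0 < lam) (x : Rn n) :
    (ENNReal.ofReal |cubeInd z r x| / ENNReal.ofReal lam) ^ (p x) =
      (cube z r).indicator (fun x => ENNReal.ofReal (Real.exp (-Real.log lam * p x))) x := by
  by_cases hx : x ∈ cube z r
  · simp only [cubeInd, Set.indicator_of_mem hx, Pi.one_apply, abs_one]
    rw [← ENNReal.ofReal_div_of_pos hl, ENNReal.ofReal_rpow_of_pos (by positivity),
      Real.rpow_def_of_pos (by positivity)]
    simp
  · simp [cubeInd, Set.indicator_of_notMem hx, hp x]

lemma norm_upper {n : ℕ} (p : Rn n → ℝ) (pm K L : ℝ) (hpm : 0 < pm) (hK : 0 ≤ K)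
    (hpmle : ∀ x, pm ≤ p x) (z : Rn n) (r : ℝ)
    (hV : volume (cube z r) = ENNReal.ofReal (Real.exp (-L)))
    (hosc : ∀ x ∈ cube z r, (p x - p z) * L ≤ K) :
    varLpNorm p (cubeInd z r) ≤
      ENNReal.ofReal (Real.exp (K / pm ^ 2) * Real.exp (-L) ^ (1 / p z)) := by
  have hq : 0 < p z := hpm.trans_le (hpmle z)
  unfold varLpNorm varLpNormE
  apply sInf_le
  refine ⟨_, by positivity, rfl, ?_⟩
  simp_rw [ind_pow p (fun x => hpm.trans_le (hpmle x)) z r _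
    (by positivity : 0 < Real.exp (K / pm ^ 2) * Real.exp (-L) ^ (1 / p z))]
  calc _ ≤ ∫⁻ x, (cube z r).indicator (fun _ => ENNReal.ofReal (Real.exp L)) x := by
        apply lintegral_mono
        intro x
        apply Set.indicator_le_indicator'
        intro hx
        apply ENNReal.ofReal_le_ofReal
        apply Real.exp_le_exp.2
        rw [← Real.exp_mul, ← Real.exp_add, Real.log_exp]
        have h1 := hosc x hx
        have h2 : (p x - p z) * L / p z ≤ K / pm := by
          calc _ ≤ K / p z := by gcongr
            _ ≤ _ := by have := hpmle z; gcongr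
        have h3 : K / pm ≤ K / pm ^ 2 * p x := by
          calc K / pm = K / pm ^ 2 * pm := by field_simp
            _ ≤ _ := by have := hpmle x; gcongr
        have h4 : -(K / pm ^ 2 + -L * (1 / p z)) * p x
            = L + (p x - p z) * L / p z - K / pm ^ 2 * p x := by field_simp; ring
        rw [h4]; linarith
    _ = 1 := by
        rw [lintegral_indicator_const (cube_meas z r), hV, ← ENNReal.ofReal_mul (by positivity),
          ← Real.exp_add]
        simp

lemma norm_lower {n : ℕ} (p : Rn n → ℝ) (pm K L : ℝ) (hpm : 0 < pm) (hK : 0 ≤ K)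
    (hpmle : ∀ x, pm ≤ p x) (z : Rn n) (r : ℝ)
    (hV : volume (cube z r) = ENNReal.ofReal (Real.exp (-L)))
    (hosc : ∀ x ∈ cube z r, (p z - p x) * L ≤ K) :
    ENNReal.ofReal (Real.exp (-(K / pm ^ 2)) * Real.exp (-L) ^ (1 / p z)) ≤
    varLpNorm p (cubeInd z r) := by
  have hq : 0 < p z := hpm.trans_le (hpmle z)
  unfold varLpNorm varLpNormE
  apply le_sInf
  rintro _ ⟨lam, hl, rfl, hint⟩
  apply ENNReal.ofReal_le_ofReal
  by_contra! hlt
  rw [← Real.exp_mul, ← Real.exp_add, ← Real.log_lt_iff_lt_exp hl] at hlt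
  simp_rw [ind_pow p (fun x => hpm.trans_le (hpmle x)) z r _ hl] at hint
  obtain ⟨t, ht⟩ : ∃ t, t = -(K / pm ^ 2) + -L * (1 / p z) - Real.log lam := ⟨_, rfl⟩
  have ht0 : 0 < t := by linarith
  have key : ENNReal.ofReal (Real.exp (t * pm)) ≤ 1 := by
    calc _ = ∫⁻ x, (cube z r).indicator (fun _ => ENNReal.ofReal (Real.exp (L + t * pm))) x := by
          rw [lintegral_indicator_const (cube_meas z r), hV, ← ENNReal.ofReal_mul (by positivity),
            ← Real.exp_add]
          congr 2; ring
      _ ≤ _ := by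
        apply lintegral_mono
        intro x
        apply Set.indicator_le_indicator'
        intro hx
        apply ENNReal.ofReal_le_ofReal
        apply Real.exp_le_exp.2
        have h1 := hosc x hx
        have h2 : (p z - p x) * L / p z ≤ K / pm := by
          calc _ ≤ K / p z := by gcongr
            _ ≤ _ := by have := hpmle z; gcongr
        have h3 : K / pm ≤ K / pm ^ 2 * p x := by
          calc K / pm = K / pm ^ 2 * pm := by field_simp
            _ ≤ _ := by have := hpmle x; gcongr
        have h5 : t * pm ≤ t * p x := by have := hpmle x; gcongr
        have h4 : -Real.log lam * p x
            = t * p x + L - (p z - p x) * L / p z + K / pm ^ 2 * p x := by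
          rw [ht]; field_simp; ring
        rw [h4]; linarith
      _ ≤ 1 := hint
  rw [ENNReal.ofReal_le_one, Real.exp_le_one_iff] at key
  nlinarith [mul_pos ht0 hpm]

theorem norm_char_cube_small
    {n : ℕ} (hn : 0 < n)
    (p : Rn n → ℝ)
    (c : ℝ) (hc : 0 < c)
    (hloc : ∀ x y : Rn n, ‖x - y‖ < 1/2 → |p x - p y| ≤ c / (-Real.log ‖x - y‖))
    (Cinf pinf : ℝ) (hCinf : 0 < Cinf)
    (hinf : ∀ x : Rn n, |p x - pinf| ≤ Cinf / Real.log (Real.exp 1 + ‖x‖))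
    (pm pp : ℝ) (hpm : 0 < pm) (hpmle : ∀ x, pm ≤ p x) (hple : ∀ x, p x ≤ pp) :
    ∃ C > 0, ∀ (z : Rn n) (r : ℝ), 0 < r → r ≤ 1 →
      (volume (cube z r)).toReal ^ (1 / sInf (p '' cube z r)) ≤
        C * (volume (cube z r)).toReal ^ (1 / sSup (p '' cube z r)) ∧
      (volume (cube z r)).toReal ^ (1 / sSup (p '' cube z r)) ≤
        C * (volume (cube z r)).toReal ^ (1 / sInf (p '' cube z r)) ∧
      (volume (cube z r)).toReal ^ (1 / sSup (p '' cube z r)) ≤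
        C * (volume (cube z r)).toReal ^ (1 / p z) ∧
      (volume (cube z r)).toReal ^ (1 / p z) ≤
        C * (volume (cube z r)).toReal ^ (1 / sSup (p '' cube z r)) ∧
      (volume (cube z r)).toReal ^ (1 / p z) ≤ C * (varLpNorm p (cubeInd z r)).toReal ∧
      (varLpNorm p (cubeInd z r)).toReal ≤ C * (volume (cube z r)).toReal ^ (1 / p z) := by
  obtain ⟨K, hKdef⟩ : ∃ K, K = 2 * c * n + n * Real.log (4 * n ^ 2) * (pp - pm) := ⟨_, rfl⟩
  have hn1 : (1 : ℝ) ≤ n := by exact_mod_cast hn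
  have hK : 0 ≤ K := by
    have hl4 : 0 ≤ Real.log (4 * (n:ℝ) ^ 2) := Real.log_nonneg (by nlinarith)
    have hpp : 0 ≤ pp - pm := by linarith [hpmle 0, hple 0]
    rw [hKdef]; positivity
  refine ⟨Real.exp (K / pm ^ 2), Real.exp_pos _, fun z r hr hr1 => ?_⟩
  obtain ⟨L, hL⟩ : ∃ L, L = n * (-Real.log r) := ⟨_, rfl⟩
  have hL0 : 0 ≤ L := by
    have := Real.log_nonpos hr.le hr1
    rw [hL]; exact mul_nonneg (by positivity) (by linarith)
  have hosc : ∀ x ∈ cube z r, ∀ y ∈ cube z r, (p x - p y) * L ≤ K := fun x hx y hy => by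
    rw [hL, hKdef]
    exact osc_bound hn p c hc hloc pm pp hpmle hple z x y r hr hr1 hx hy
  have hV : volume (cube z r) = ENNReal.ofReal (Real.exp (-L)) := by
    rw [cube_vol, ← ENNReal.ofReal_pow hr.le, hL, mul_neg, neg_neg, mul_comm, Real.exp_mul,
      Real.exp_log hr, Real.rpow_natCast]
  have hz : z ∈ cube z r := fun i => by simp; positivity
  have hne : (p '' cube z r).Nonempty := ⟨_, z, hz, rfl⟩
  have hbb : BddBelow (p '' cube z r) := ⟨pm, by rintro _ ⟨x, _, rfl⟩; exact hpmle x⟩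
  have hba : BddAbove (p '' cube z r) := ⟨pp, by rintro _ ⟨x, _, rfl⟩; exact hple x⟩
  have hi : pm ≤ sInf (p '' cube z r) :=
    le_csInf hne (by rintro _ ⟨x, _, rfl⟩; exact hpmle x)
  have hiz : sInf (p '' cube z r) ≤ p z := csInf_le hbb ⟨z, hz, rfl⟩
  have hzs : p z ≤ sSup (p '' cube z r) := le_csSup hba ⟨z, hz, rfl⟩
  have hmain : (sSup (p '' cube z r) - sInf (p '' cube z r)) * L ≤ K := by
    rcases hL0.eq_or_lt with h0 | h0
    · rw [← h0, mul_zero]; exact hK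
    rw [← le_div_iff₀ h0]
    have : sSup (p '' cube z r) ≤ sInf (p '' cube z r) + K / L := by
      apply csSup_le hne
      rintro _ ⟨x, hx, rfl⟩
      rw [← sub_le_iff_le_add]
      apply le_csInf hne
      rintro _ ⟨y, hy, rfl⟩
      have := (le_div_iff₀ h0).2 (hosc x hx y hy)
      linarith
    linarith
  have hsz : (sSup (p '' cube z r) - p z) * L ≤ K :=
    le_trans (mul_le_mul_of_nonneg_right (by linarith) hL0) hmain
  have hneg : ∀ a b : ℝ, a ≤ b → (a - b) * L ≤ K := fun a b h =>
    (mul_nonpos_of_nonpos_of_nonneg (by linarith) hL0).trans hK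
  have hup := norm_upper p pm K L hpm hK hpmle z r hV fun x hx => hosc x hx z hz
  have hlo := norm_lower p pm K L hpm hK hpmle z r hV fun x hx => hosc z hz x hx
  have hVr : (volume (cube z r)).toReal = Real.exp (-L) := by
    rw [hV, ENNReal.toReal_ofReal (Real.exp_pos _).le]
  rw [hVr]
  have hs : pm ≤ sSup (p '' cube z r) := by linarith
  refine ⟨exp_cmp hpm hK hi hs (hneg _ _ (by linarith)), exp_cmp hpm hK hs hi hmain,
    exp_cmp hpm hK hs (hpmle z) hsz, exp_cmp hpm hK (hpmle z) hs (hneg _ _ hzs), ?_, ?_⟩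
  · have h1 := (ENNReal.ofReal_le_iff_le_toReal (ne_top_of_le_ne_top ENNReal.ofReal_ne_top hup)).1 hlo
    rw [Real.exp_neg, inv_mul_le_iff₀ (Real.exp_pos _)] at h1
    exact h1
  · exact ENNReal.toReal_le_of_le_ofReal (by positivity) hup
end

section
/- Suppose p : ℝⁿ → (0,∞) satisfies the local log-Hölder condition and the log-Hölder condition at infinity with constants p_∞, C_∞, and 0 < p₋ ≤ p₊ < ∞. Then for all cubes Q = Q(z,r) with z ∈ ℝⁿ and side length r ≥ 1, one has |Q|^{1/p_∞} ∼ ‖χ_Q‖_{p(·)}, where the implicit constants do not depend on z and r. -/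
open MeasureTheory ENNReal

theorem ncc_vol {n : ℕ} (z : Rn n) (r : ℝ) (hr : 0 ≤ r) :
    MeasurableSet (cube z r) ∧ volume (cube z r) = ENNReal.ofReal (r ^ n) := by
  have h : cube z r = (MeasurableEquiv.toLp 2 (Fin n → ℝ)).symm ⁻¹'
      (Set.Icc (fun i => z i - r / 2) (fun i => z i + r / 2)) := by
    ext x
    simp only [cube, Set.mem_ofPred_eq, Set.mem_preimage, Set.mem_Icc, Pi.le_def, abs_le]
    constructor
    · intro h
      exact ⟨fun i => by have := (h i).1; change z i - r / 2 ≤ x i; linarith,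
        fun i => by have := (h i).2; change x i ≤ z i + r / 2; linarith⟩
    · rintro ⟨h1, h2⟩ i
      have h1 : z i - r / 2 ≤ x i := h1 i
      have h2 : x i ≤ z i + r / 2 := h2 i
      constructor <;> linarith
  refine ⟨?_, ?_⟩
  · rw [h]
    exact (MeasurableEquiv.toLp 2 (Fin n → ℝ)).symm.measurable measurableSet_Icc
  · rw [h, (EuclideanSpace.volume_preserving_symm_measurableEquiv_toLp (Fin n)).measure_preimage_equiv,
      Real.volume_Icc_pi]
    simp [ENNReal.ofReal_pow hr]

theorem ncc_int {n : ℕ} (p : Rn n → ℝ) (hp : ∀ x, 0 < p x) (z : Rn n) (r lam : ℝ) (hl : 0 < lam)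
    (x : Rn n) :
    (ENNReal.ofReal |cubeInd z r x| / ENNReal.ofReal lam) ^ (p x) =
      (cube z r).indicator (fun x => ENNReal.ofReal (lam ^ (-p x))) x := by
  by_cases hx : x ∈ cube z r
  · simp only [cubeInd, Set.indicator_of_mem hx, Pi.one_apply, abs_one]
    rw [← ENNReal.ofReal_div_of_pos hl, ENNReal.ofReal_rpow_of_pos (by positivity), Real.rpow_neg hl.le,
      one_div, Real.inv_rpow hl.le]
  · simp [cubeInd, Set.indicator_of_notMem hx, hp x]

theorem ncc_out {n : ℕ} {x : Rn n} {t : ℝ} (hx : x ∉ cube (0 : Rn n) (2 * t)) : t ≤ ‖x‖ := by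
  simp only [cube, Set.mem_ofPred_eq, not_forall, not_le] at hx
  obtain ⟨i, hi⟩ := hx
  have := PiLp.norm_apply_le x i
  rw [Real.norm_eq_abs] at this
  simp at hi
  linarith

/-- key estimate -/
theorem ncc_key {n : ℕ} (p : Rn n → ℝ) (Cinf pinf : ℝ)
    (hinf : ∀ x : Rn n, |p x - pinf| ≤ Cinf / Real.log (Real.exp 1 + ‖x‖)) (hp : 0 < pinf)
    (δ : ℝ) (hδ : 0 < δ) (r : ℝ) (hr : 1 ≤ r) (x : Rn n)
    (hx : r ^ δ ≤ Real.exp 1 + ‖x‖) :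
    Real.exp (-(n * (Cinf / δ) / pinf)) / r ^ n ≤ (r ^ (n / pinf : ℝ)) ^ (-p x) ∧
    (r ^ (n / pinf : ℝ)) ^ (-p x) ≤ Real.exp (n * (Cinf / δ) / pinf) / r ^ n := by
  have r0 : 0 < r := by linarith
  have hlr : 0 ≤ Real.log r := Real.log_nonneg hr
  have h1 : δ * Real.log r ≤ Real.log (Real.exp 1 + ‖x‖) := by
    rw [← Real.log_rpow r0]
    exact Real.log_le_log (by positivity) hx
  have h2 : 0 < Real.log (Real.exp 1 + ‖x‖) := by
    apply Real.log_pos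
    have := Real.add_one_lt_exp (one_ne_zero (α := ℝ))
    have := norm_nonneg x
    linarith
  have h3 : |p x - pinf| * Real.log r ≤ Cinf / δ := by
    have := hinf x
    rw [le_div_iff₀ h2] at this
    rw [le_div_iff₀ hδ]
    have := mul_le_mul_of_nonneg_left h1 (abs_nonneg (p x - pinf))
    nlinarith
  have e : (r ^ (n / pinf : ℝ)) ^ (-p x) =
      Real.exp (n / pinf * (-((p x - pinf) * Real.log r))) / r ^ n := by
    rw [← Real.rpow_mul r0.le, ← Real.rpow_natCast, Real.rpow_def_of_pos r0, Real.rpow_def_of_pos r0,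
      ← Real.exp_sub]
    congr 1
    field_simp
    ring
  have h4 : |(p x - pinf) * Real.log r| ≤ Cinf / δ := by
    rwa [abs_mul, abs_of_nonneg hlr]
  rw [abs_le] at h4
  have hnp : 0 ≤ (n / pinf : ℝ) := by positivity
  rw [e]
  have e1 : -(n * (Cinf / δ) / pinf) = n / pinf * (-(Cinf / δ)) := by ring
  have e2 : (n * (Cinf / δ) / pinf) = n / pinf * ((Cinf / δ)) := by ring
  rw [e1, e2]
  constructor
  · apply div_le_div_of_nonneg_right _ (by positivity)
    apply Real.exp_le_exp.2 (mul_le_mul_of_nonneg_left _ hnp)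
    linarith
  · apply div_le_div_of_nonneg_right _ (by positivity)
    apply Real.exp_le_exp.2 (mul_le_mul_of_nonneg_left _ hnp)
    linarith

theorem ncc_pinf {n : ℕ} (hn : 0 < n) (p : Rn n → ℝ) (Cinf pinf : ℝ) (hC : 0 < Cinf)
    (hinf : ∀ x : Rn n, |p x - pinf| ≤ Cinf / Real.log (Real.exp 1 + ‖x‖))
    (pm : ℝ) (hpm : 0 < pm) (hpmle : ∀ x, pm ≤ p x) : 0 < pinf := by
  by_contra! hneg
  set t := Real.exp (Cinf / pm + 1) with ht
  have h := hinf (EuclideanSpace.single ⟨0, hn⟩ t)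
  have h' := hpmle (EuclideanSpace.single ⟨0, hn⟩ t)
  rw [EuclideanSpace.norm_single, Real.norm_eq_abs, abs_of_pos (Real.exp_pos _)] at h
  have hl : Cinf / pm + 1 ≤ Real.log (Real.exp 1 + t) := by
    rw [Real.le_log_iff_exp_le (by positivity)]
    have := Real.exp_pos 1
    linarith
  have hq : 0 < Cinf / pm := by positivity
  have h2 : pm ≤ Cinf / Real.log (Real.exp 1 + t) := by
    have := le_abs_self (p (EuclideanSpace.single ⟨0, hn⟩ t) - pinf)
    linarith
  rw [le_div_iff₀ (by linarith)] at h2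
  have h3 : pm * (Cinf / pm + 1) = Cinf + pm := by field_simp
  nlinarith

theorem ncc_upper {n : ℕ} (p : Rn n → ℝ) (Cinf pinf : ℝ) (hC : 0 < Cinf)
    (hinf : ∀ x : Rn n, |p x - pinf| ≤ Cinf / Real.log (Real.exp 1 + ‖x‖)) (hp : 0 < pinf)
    (pm : ℝ) (hpm : 0 < pm) (hpmle : ∀ x, pm ≤ p x) :
    ∃ K > 0, ∀ (z : Rn n) (r : ℝ), 1 ≤ r →
      varLpNorm p (cubeInd z r) ≤ ENNReal.ofReal (K * r ^ (n / pinf : ℝ)) := by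
  set δ := pm / pinf with hδ
  have hδ0 : 0 < δ := by positivity
  set E := Real.exp (n * (Cinf / δ) / pinf) with hE
  have hE1 : 1 ≤ E := Real.one_le_exp (by positivity)
  set K := (E + 2 ^ n) ^ (1 / pm) with hK
  have hS : 1 ≤ E + 2 ^ n := by
    have : (0:ℝ) < 2 ^ n := by positivity
    linarith
  have hK1 : 1 ≤ K := Real.one_le_rpow hS (by positivity)
  have hKpm : K ^ (-pm) = (E + 2 ^ n)⁻¹ := by
    rw [Real.rpow_neg (by linarith), hK, ← Real.rpow_mul (by linarith), one_div_mul_cancel hpm.ne', Real.rpow_one]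
  refine ⟨K, by linarith, fun z r hr => ?_⟩
  have r0 : 0 < r := by linarith
  set s := r ^ (n / pinf : ℝ) with hs
  have hs1 : 1 ≤ s := Real.one_le_rpow hr (by positivity)
  apply sInf_le
  refine ⟨K * s, by positivity, rfl, ?_⟩
  simp_rw [ncc_int p (fun x => hpm.trans_le (hpmle x)) z r (K * s) (by positivity)]
  set c1 := K ^ (-pm) * (E / r ^ n) with hc1
  set c2 := K ^ (-pm) * s ^ (-pm) with hc2
  set F := cube (0 : Rn n) (2 * r ^ δ) with hF
  have hbound : ∀ x, (cube z r).indicator (fun x => ENNReal.ofReal ((K * s) ^ (-p x))) x ≤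
      (cube z r).indicator (fun _ => ENNReal.ofReal c1) x + F.indicator (fun _ => ENNReal.ofReal c2) x := by
    intro x
    by_cases hx : x ∈ cube z r
    swap
    · simp [hx]
    rw [Set.indicator_of_mem hx, Set.indicator_of_mem hx]
    have hKx : K ^ (-p x) ≤ K ^ (-pm) := Real.rpow_le_rpow_of_exponent_le hK1 (by linarith [hpmle x])
    rw [Real.mul_rpow (by positivity) (by positivity)]
    by_cases hxF : x ∈ F
    · rw [Set.indicator_of_mem hxF]
      refine le_trans (ENNReal.ofReal_le_ofReal ?_) le_add_self
      have : s ^ (-p x) ≤ s ^ (-pm) := Real.rpow_le_rpow_of_exponent_le hs1 (by linarith [hpmle x])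
      rw [hc2]
      gcongr
    · rw [Set.indicator_of_notMem hxF, add_zero]
      apply ENNReal.ofReal_le_ofReal
      have h1 := ncc_out hxF
      have := (ncc_key p Cinf pinf hinf hp δ hδ0 r hr x (by have := Real.exp_pos 1; linarith)).2
      rw [hc1]
      gcongr
  obtain ⟨mQ, vQ⟩ := ncc_vol z r r0.le
  obtain ⟨mF, vF⟩ := ncc_vol (0 : Rn n) (2 * r ^ δ) (by positivity)
  refine (lintegral_mono hbound).trans ?_
  rw [lintegral_add_left (measurable_const.indicator mQ), lintegral_indicator_const mQ,
    lintegral_indicator_const mF, vQ, vF, ← ENNReal.ofReal_mul (by positivity),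
    ← ENNReal.ofReal_mul (by positivity), ← ENNReal.ofReal_add (by positivity) (by positivity)]
  rw [← ENNReal.ofReal_one]
  apply ENNReal.ofReal_le_ofReal
  have e1 : s ^ (-pm) * (2 * r ^ δ) ^ n = 2 ^ n := by
    rw [mul_pow, ← Real.rpow_natCast (r ^ δ), hs, ← Real.rpow_mul r0.le, ← Real.rpow_mul r0.le]
    rw [mul_left_comm, ← Real.rpow_add r0]
    have : (n / pinf : ℝ) * -pm + δ * n = 0 := by rw [hδ]; field_simp; ring
    rw [this]; simp
  have e2 : E / r ^ n * r ^ n = E := by field_simp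
  rw [hc1, hc2, mul_assoc, mul_assoc, e1, e2, ← mul_add, hKpm]
  rw [inv_mul_cancel₀ (by linarith)]

theorem ncc_lower {n : ℕ} (hn : 0 < n) (p : Rn n → ℝ) (Cinf pinf : ℝ) (hC : 0 < Cinf)
    (hinf : ∀ x : Rn n, |p x - pinf| ≤ Cinf / Real.log (Real.exp 1 + ‖x‖)) (hp : 0 < pinf)
    (pm : ℝ) (hpm : 0 < pm) (hpmle : ∀ x, pm ≤ p x) :
    ∃ L > 0, ∀ (z : Rn n) (r : ℝ), 1 ≤ r →
      ENNReal.ofReal (r ^ (n / pinf : ℝ) / L) ≤ varLpNorm p (cubeInd z r) := by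
  set E := Real.exp (n * (Cinf / (1/2)) / pinf) with hE
  have hE1 : 1 ≤ E := Real.one_le_exp (by positivity)
  set L := (4 * E) ^ (1 / pm) with hL
  have hL1 : 1 ≤ L := Real.one_le_rpow (by linarith) (by positivity)
  have hLpm : L ^ pm = 4 * E := by
    rw [hL, ← Real.rpow_mul (by linarith), one_div_mul_cancel hpm.ne', Real.rpow_one]
  refine ⟨L, by linarith, fun z r hr => ?_⟩
  have r0 : 0 < r := by linarith
  set s := r ^ (n / pinf : ℝ) with hs
  have hs1 : 1 ≤ s := Real.one_le_rpow hr (by positivity)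
  apply le_sInf
  rintro l ⟨lam, hlam, rfl, hint⟩
  by_contra! hlt
  have hlt : lam < s / L := by
    by_contra! h
    exact absurd (ENNReal.ofReal_le_ofReal h) (not_le.2 hlt)
  simp_rw [ncc_int p (fun x => hpm.trans_le (hpmle x)) z r lam hlam] at hint
  obtain ⟨mQ, vQ⟩ := ncc_vol z r r0.le
  obtain ⟨mF, vF⟩ := ncc_vol (0 : Rn n) (2 * (r / 4)) (by positivity)
  set F := cube (0 : Rn n) (2 * (r / 4)) with hF
  have hbound : ∀ x, (cube z r \ F).indicator (fun _ => ENNReal.ofReal (4 / r ^ n)) x ≤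
      (cube z r).indicator (fun x => ENNReal.ofReal (lam ^ (-p x))) x := by
    intro x
    by_cases hx : x ∈ cube z r \ F
    swap
    · simp [hx]
    rw [Set.indicator_of_mem hx, Set.indicator_of_mem hx.1]
    apply ENNReal.ofReal_le_ofReal
    have h1 := ncc_out hx.2
    have h2 : r ^ (1 / 2 : ℝ) ≤ Real.exp 1 + ‖x‖ := by
      rw [← Real.sqrt_eq_rpow]
      have := Real.add_one_lt_exp (one_ne_zero (α := ℝ))
      have := Real.sq_sqrt r0.le
      nlinarith [sq_nonneg (√r / 2 - 1)]
    have h3 := (ncc_key p Cinf pinf hinf hp (1/2) (by norm_num) r hr x h2).1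
    rw [Real.exp_neg] at h3
    have hpx := hpmle x
    calc 4 / r ^ n = (4 * E) * (E⁻¹ / r ^ n) := by field_simp
      _ ≤ L ^ p x * s ^ (-p x) := by
        rw [← hLpm]
        gcongr
      _ = (s / L) ^ (-p x) := by
        rw [Real.div_rpow (by positivity) (by positivity), Real.rpow_neg (by positivity : 0 ≤ L)]
        field_simp
      _ ≤ lam ^ (-p x) := Real.rpow_le_rpow_of_nonpos hlam hlt.le (by linarith)
  have h5 := (lintegral_mono hbound).trans hint
  rw [lintegral_indicator_const (mQ.diff mF)] at h5
  have h6 : ENNReal.ofReal (r ^ n / 2) ≤ volume (cube z r \ F) := by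
    refine le_trans ?_ (le_measure_sdiff)
    rw [vQ, vF, ← ENNReal.ofReal_sub _ (by positivity)]
    apply ENNReal.ofReal_le_ofReal
    have e : (2 * (r / 4)) ^ n = r ^ n * (1 / 2) ^ n := by rw [← mul_pow]; ring
    have h7 : ((1:ℝ) / 2) ^ n ≤ 1 / 2 := pow_le_of_le_one (by norm_num) (by norm_num) hn.ne'
    have : 0 < r ^ n := by positivity
    rw [e]
    nlinarith
  have h8 := (mul_le_mul_right h6 (ENNReal.ofReal (4 / r ^ n))).trans h5
  rw [← ENNReal.ofReal_mul (by positivity)] at h8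
  have : 4 / r ^ n * (r ^ n / 2) = 2 := by field_simp; norm_num
  rw [this, ← ENNReal.ofReal_one, ENNReal.ofReal_le_ofReal_iff (by norm_num)] at h8
  norm_num at h8

theorem norm_char_cube_large
    {n : ℕ} (hn : 0 < n)
    (p : Rn n → ℝ)
    (c : ℝ) (hc : 0 < c)
    (hloc : ∀ x y : Rn n, ‖x - y‖ < 1/2 → |p x - p y| ≤ c / (-Real.log ‖x - y‖))
    (Cinf pinf : ℝ) (hCinf : 0 < Cinf)
    (hinf : ∀ x : Rn n, |p x - pinf| ≤ Cinf / Real.log (Real.exp 1 + ‖x‖))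
    (pm pp : ℝ) (hpm : 0 < pm) (hpmle : ∀ x, pm ≤ p x) (hple : ∀ x, p x ≤ pp) :
    ∃ C > 0, ∀ (z : Rn n) (r : ℝ), 1 ≤ r →
      (volume (cube z r)).toReal ^ (1 / pinf) ≤ C * (varLpNorm p (cubeInd z r)).toReal ∧
      (varLpNorm p (cubeInd z r)).toReal ≤ C * (volume (cube z r)).toReal ^ (1 / pinf) := by
  have hp := ncc_pinf hn p Cinf pinf hCinf hinf pm hpm hpmle
  obtain ⟨K, hK, hup⟩ := ncc_upper p Cinf pinf hCinf hinf hp pm hpm hpmle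
  obtain ⟨L, hL, hlow⟩ := ncc_lower hn p Cinf pinf hCinf hinf hp pm hpm hpmle
  refine ⟨K + L, by positivity, fun z r hr => ?_⟩
  have r0 : 0 < r := by linarith
  have e : (volume (cube z r)).toReal ^ (1 / pinf) = r ^ (n / pinf : ℝ) := by
    rw [(ncc_vol z r r0.le).2, ENNReal.toReal_ofReal (by positivity), ← Real.rpow_natCast,
      ← Real.rpow_mul r0.le]
    congr 1
    ring
  rw [e]
  have h1 := hup z r hr
  have h2 := hlow z r hr
  have h0 : 0 ≤ r ^ (n / pinf : ℝ) := by positivity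
  have h3 := ENNReal.toReal_le_of_le_ofReal (by positivity) h1
  have h4 := (ENNReal.ofReal_le_iff_le_toReal (ne_top_of_le_ne_top ENNReal.ofReal_ne_top h1)).1 h2
  rw [div_le_iff₀ hL] at h4
  have h5 : 0 ≤ (varLpNorm p (cubeInd z r)).toReal := ENNReal.toReal_nonneg
  constructor <;> nlinarith
end

section
/- Let p : ℝⁿ → (0,∞) be a bounded measurable function. The following two conditions are equivalent: (i) there is a constant c > 0 such that |p(x) − p(y)| ≤ c/log(e + |x|) whenever |y| ≥ |x|; (ii) there exist constants C_∞ > 0 and p_∞ ∈ ℝ such that |p(x) − p_∞| ≤ C_∞/log(e + |x|) for all x ∈ ℝⁿ. -/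
open MeasureTheory ENNReal

theorem logHolder_infty_equivalence
    {n : ℕ} (p : Rn n → ℝ) (hpos : ∀ x, 0 < p x)
    (hmeas : Measurable p) (B : ℝ) (hB : ∀ x, p x ≤ B) :
    (∃ c > 0, ∀ x y : Rn n, ‖x‖ ≤ ‖y‖ →
        |p x - p y| ≤ c / Real.log (Real.exp 1 + ‖x‖)) ↔
    (∃ C > 0, ∃ pinf : ℝ, ∀ x : Rn n,
        |p x - pinf| ≤ C / Real.log (Real.exp 1 + ‖x‖)) := by
  have hlog : ∀ x : Rn n, 0 < Real.log (Real.exp 1 + ‖x‖) := by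
    intro x
    apply Real.log_pos
    have h1 := Real.add_one_le_exp (1 : ℝ)
    have h2 := norm_nonneg x
    linarith
  constructor
  · rintro ⟨c, hc, h⟩
    have key : ∀ x y : Rn n, p x - c / Real.log (Real.exp 1 + ‖x‖) ≤
        p y + c / Real.log (Real.exp 1 + ‖y‖) := by
      intro x y
      have hx := div_pos hc (hlog x)
      have hy := div_pos hc (hlog y)
      rcases le_total ‖x‖ ‖y‖ with hxy | hxy
      · have := abs_le.mp (h x y hxy)
        linarith [this.1, this.2]
      · have := abs_le.mp (h y x hxy)
        linarith [this.1, this.2]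
    refine ⟨c, hc, ⨆ x : Rn n, (p x - c / Real.log (Real.exp 1 + ‖x‖)), fun x => ?_⟩
    have hbdd : BddAbove (Set.range fun x : Rn n =>
        (p x - c / Real.log (Real.exp 1 + ‖x‖))) := by
      refine ⟨p x + c / Real.log (Real.exp 1 + ‖x‖), ?_⟩
      rintro _ ⟨y, rfl⟩
      exact key y x
    have h1 := le_ciSup hbdd x
    have h2 := ciSup_le (fun y => key y x)
    rw [abs_le]
    constructor <;> linarith
  · rintro ⟨C, hC, q, h⟩
    refine ⟨2 * C, by positivity, fun x y hxy => ?_⟩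
    have hx := abs_le.mp (h x)
    have hy := abs_le.mp (h y)
    have hle : C / Real.log (Real.exp 1 + ‖y‖) ≤ C / Real.log (Real.exp 1 + ‖x‖) := by
      apply div_le_div_of_nonneg_left hC.le (hlog x)
      apply Real.log_le_log
      · have := Real.exp_pos 1
        have := norm_nonneg x
        linarith
      · linarith
    rw [mul_div_assoc, abs_le]
    constructor <;> linarith [hx.1, hx.2, hy.1, hy.2]
end
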